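/- For any bounded measurable function φ on X, with V̂_n^N(φ) = V_n^N(φ̂) / η_n^N(G_n)²: (1) E[γ̂_n^N(1)² V̂_n^N(φ)] = var(γ̂_n^N(φ)) for all N ≥ 1; (2) N V̂_n^N(φ) → σ̂_n²(φ) in probability as N → ∞; (3) N V̂_n^N(φ − η̂_n^N(φ)) → σ̂_n²(φ − η̂_n(φ)) in probability as N → ∞. -/

import Mathlib

open MeasureTheory ProbabilityTheory Filter
open scoped ENNReal NNReal Classical

noncomputable section

namespace PFVar

variable {X : Type*} [MeasurableSpace X]

/-- The unnormalized Feynman–Kac measures `γ_p`. -/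
def gammaFK (M0 : Measure X) (M : ℕ → Kernel X X) (G : ℕ → X → ℝ) : ℕ → Measure X
  | 0 => M0
  | p + 1 =>
      ((gammaFK M0 M G p).withDensity fun x => ENNReal.ofReal (G p x)).bind
        (fun x => M (p + 1) x)

/-- `γ_n(φ)`. -/
def gInt (M0 : Measure X) (M : ℕ → Kernel X X) (G : ℕ → X → ℝ) (n : ℕ) (φ : X → ℝ) : ℝ :=
  ∫ x, φ x ∂(gammaFK M0 M G n)

/-- `η_n(φ) = γ_n(φ)/γ_n(1)`. -/
def eInt (M0 : Measure X) (M : ℕ → Kernel X X) (G : ℕ → X → ℝ) (n : ℕ) (φ : X → ℝ) : ℝ :=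
  gInt M0 M G n φ / gInt M0 M G n 1

/-- Law of the path `(X_0,…,X_k)` of an inhomogeneous Markov chain with initial law `μ0` and
transitions `κ`, recorded as an element of `ℕ → Y` (coordinates beyond `k` are junk). -/
def markovPath {Y : Type*} [MeasurableSpace Y] (μ0 : Measure Y) (κ : ℕ → Y → Measure Y) :
    ℕ → Measure (ℕ → Y)
  | 0 => μ0.map fun y _ => y
  | k + 1 =>
      (markovPath μ0 κ k).bind fun ω =>
        (κ (k + 1) (ω k)).map fun y => Function.update ω (k + 1) y

/-- Categorical distribution on `{0,…,m−1} ⊆ ℕ` with weights `w`. -/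
def cat (m : ℕ) (w : ℕ → ℝ) : Measure ℕ :=
  (∑ j ∈ Finset.range m, ENNReal.ofReal (w j))⁻¹ •
    ∑ j ∈ Finset.range m, ENNReal.ofReal (w j) • Measure.dirac j

/-- Uniform distribution on `{0,…,m−1}`. -/
def unif (m : ℕ) : Measure ℕ := cat m fun _ => 1

/-- Extend a finite tuple to `ℕ` with junk values. -/
def padF {Y : Type*} [Nonempty Y] {m : ℕ} (f : Fin m → Y) : ℕ → Y := fun i =>
  if h : i < m then f ⟨i, h⟩ else Classical.arbitrary Y

/-- One resampling/mutation step of the particle filter: given the time-`p` configuration `z`,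
the joint law of the ancestor indices `A_p` and the time-`p+1` particle configuration;
each of the `Np (p+1)` new particles independently draws an ancestor from the categorical
distribution with weights `G p (z j)`, `j < Np p`, and then moves according to `M (p+1)`. -/
def pfStep [Nonempty X] (M : ℕ → Kernel X X) (G : ℕ → X → ℝ) (Np : ℕ → ℕ) (p : ℕ)
    (z : ℕ → X) : Measure ((ℕ → ℕ) × (ℕ → X)) :=
  (Measure.pi fun _ : Fin (Np (p + 1)) =>
      (cat (Np p) fun j => G p (z j)).bind fun a =>
        (M (p + 1) (z a)).map fun x => (a, x)).map fun f =>
    (padF fun i => (f i).1, padF fun i => (f i).2)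

/-- The law of the particle system `(ζ, A)` run up to time `k`: the first component is
`ζ : time → particle index → X`, the second is `A : time → particle index → ℕ`, where
`A p i` is the ancestor index of particle `i` of generation `p+1`. -/
def pfLaw [Nonempty X] (M0 : Measure X) (M : ℕ → Kernel X X) (G : ℕ → X → ℝ)
    (Np : ℕ → ℕ) : ℕ → Measure ((ℕ → ℕ → X) × (ℕ → ℕ → ℕ))
  | 0 =>
      (Measure.pi fun _ : Fin (Np 0) => M0).map fun f =>
        (fun p => if p = 0 then padF f else fun _ => Classical.arbitrary X, fun _ _ => 0)
  | k + 1 =>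
      (pfLaw M0 M G Np k).bind fun ω =>
        (pfStep M G Np k (ω.1 k)).map fun az =>
          (Function.update ω.1 (k + 1) az.2, Function.update ω.2 k az.1)

/-- Eve indices: `eve A 0 i = i` and `eve A (p+1) i = eve A p (A p i)`. -/
def eve (A : ℕ → ℕ → ℕ) : ℕ → ℕ → ℕ
  | 0 => fun i => i
  | p + 1 => fun i => eve A p (A p i)

/-- `η_n^N(φ)`. -/
def etaN (Np : ℕ → ℕ) (n : ℕ) (φ : X → ℝ) (ω : (ℕ → ℕ → X) × (ℕ → ℕ → ℕ)) : ℝ :=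
  (Np n : ℝ)⁻¹ * ∑ i ∈ Finset.range (Np n), φ (ω.1 n i)

/-- `γ_n^N(φ)`. -/
def gammaN (G : ℕ → X → ℝ) (Np : ℕ → ℕ) (n : ℕ) (φ : X → ℝ)
    (ω : (ℕ → ℕ → X) × (ℕ → ℕ → ℕ)) : ℝ :=
  (∏ p ∈ Finset.range n, etaN Np p (G p) ω) * etaN Np n φ ω

/-- The variance estimator `V_n^N(φ)`. -/
def Vest (Np : ℕ → ℕ) (n : ℕ) (φ : X → ℝ) (ω : (ℕ → ℕ → X) × (ℕ → ℕ → ℕ)) : ℝ :=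
  etaN Np n φ ω ^ 2 -
    (∏ p ∈ Finset.range n, (Np p : ℝ) / ((Np p : ℝ) - 1)) *
      ((Np n : ℝ) * ((Np n : ℝ) - 1))⁻¹ *
      ∑ i ∈ Finset.range (Np n), ∑ j ∈ Finset.range (Np n),
        if eve ω.2 n i ≠ eve ω.2 n j then φ (ω.1 n i) * φ (ω.1 n j) else 0

/-- Initial law of the doubled chain used to define `μ_b`. -/
def pairInit (M0 : Measure X) (b : ℕ → Bool) : Measure (X × X) :=
  if b 0 then M0.map fun x => (x, x) else M0.prod M0

/-- Transitions of the doubled chain used to define `μ_b`. -/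
def pairKer (M : ℕ → Kernel X X) (b : ℕ → Bool) (p : ℕ) (q : X × X) : Measure (X × X) :=
  if b p then (M p q.1).map fun y => (y, y) else (M p q.1).prod (M p q.2)

/-- `μ_b(φ) = E_b[φ(X_n, X_n') ∏_{p<n} G_p(X_p) G_p(X_p')]`. -/
def muB (M0 : Measure X) (M : ℕ → Kernel X X) (G : ℕ → X → ℝ) (n : ℕ) (b : ℕ → Bool)
    (φ : X × X → ℝ) : ℝ :=
  ∫ ω, φ (ω n) * ∏ p ∈ Finset.range n, G p (ω p).1 * G p (ω p).2
    ∂(markovPath (pairInit M0 b) (pairKer M b) n)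

/-- `φ ⊗ φ`. -/
def tens (φ : X → ℝ) : X × X → ℝ := fun q => φ q.1 * φ q.2

/-- The binary string `e_p`. -/
def eVec (p : ℕ) : ℕ → Bool := fun q => q == p

/-- The zero binary string `0_n`. -/
def zeroVec : ℕ → Bool := fun _ => false

/-- Extension of a finite binary string to `ℕ → Bool`. -/
def extB (n : ℕ) (b : Fin (n + 1) → Bool) : ℕ → Bool := fun p =>
  if h : p < n + 1 then b ⟨p, h⟩ else false

/-- `v_{p,n}(φ) = (μ_{e_p}(φ⊗φ) − μ_{0_n}(φ⊗φ)) / γ_n(1)²`. -/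
def vpn (M0 : Measure X) (M : ℕ → Kernel X X) (G : ℕ → X → ℝ) (n p : ℕ) (φ : X → ℝ) : ℝ :=
  (muB M0 M G n (eVec p) (tens φ) - muB M0 M G n zeroVec (tens φ)) / gInt M0 M G n 1 ^ 2

/-- `σ_n²(φ) = Σ_{p=0}^n c_p⁻¹ v_{p,n}(φ)`. -/
def sigma2 (M0 : Measure X) (M : ℕ → Kernel X X) (G : ℕ → X → ℝ) (c : ℕ → ℝ) (n : ℕ)
    (φ : X → ℝ) : ℝ :=
  ∑ p ∈ Finset.range (n + 1), (c p)⁻¹ * vpn M0 M G n p φ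

/-- Particle numbers `N_p = ⌈c_p N⌉`. -/
def npart (c : ℕ → ℝ) (N : ℕ) (p : ℕ) : ℕ := ⌈c p * (N : ℝ)⌉₊

/-- Backward tracing: `traceAux A n kn j = K_{n-j}` where `K_n = kn`, `K_p = A p (K_{p+1})`. -/
def traceAux (A : ℕ → ℕ → ℕ) (n kn : ℕ) : ℕ → ℕ
  | 0 => kn
  | j + 1 => A (n - (j + 1)) (traceAux A n kn j)

/-- The deterministic ancestral trace `K¹`: `trace A n kn p = K_p¹` given `K_n¹ = kn`. -/
def trace (A : ℕ → ℕ → ℕ) (n kn : ℕ) : ℕ → ℕ := fun p => traceAux A n kn (n - p)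

/-- Conditional law of the broken-lineage trace `(K_0²,…,K_p²)` given `K_p² = v`
(entries above `p` are junk, to be overwritten). -/
def k2Law (G : ℕ → X → ℝ) (Np : ℕ → ℕ) (ω : (ℕ → ℕ → X) × (ℕ → ℕ → ℕ)) (K1 : ℕ → ℕ) :
    ℕ → ℕ → Measure (ℕ → ℕ)
  | 0 => fun v => Measure.dirac fun q => if q = 0 then v else 0
  | p + 1 => fun v =>
      ((if v = K1 (p + 1) then cat (Np p) fun j => G p (ω.1 p j)
          else Measure.dirac (ω.2 p v)).bind fun w =>
        (k2Law G Np ω K1 p w).map fun f => Function.update f (p + 1) v)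

/-- Conditional law of `(K¹, K²)` given the particle system `ω = (ζ, A)`. -/
def kLaw (G : ℕ → X → ℝ) (Np : ℕ → ℕ) (n : ℕ) (ω : (ℕ → ℕ → X) × (ℕ → ℕ → ℕ)) :
    Measure ((ℕ → ℕ) × (ℕ → ℕ)) :=
  (unif (Np n)).bind fun k1n =>
    (unif (Np n)).bind fun k2n =>
      (k2Law G Np ω (trace ω.2 n k1n) n k2n).map fun k2 => (trace ω.2 n k1n, k2)

/-- Joint law of the particle system together with the tracing variables `(K¹, K²)`. -/
def pfkLaw [Nonempty X] (M0 : Measure X) (M : ℕ → Kernel X X) (G : ℕ → X → ℝ)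
    (Np : ℕ → ℕ) (n : ℕ) :
    Measure (((ℕ → ℕ → X) × (ℕ → ℕ → ℕ)) × ((ℕ → ℕ) × (ℕ → ℕ))) :=
  (pfLaw M0 M G Np n).bind fun ω => (kLaw G Np n ω).map fun k => (ω, k)

/-- `(k¹, k²) ∈ I(b)`. -/
def inI (Np : ℕ → ℕ) (n : ℕ) (b : ℕ → Bool) (k : (ℕ → ℕ) × (ℕ → ℕ)) : Prop :=
  ∀ p ≤ n, k.1 p < Np p ∧ k.2 p < Np p ∧ (k.1 p = k.2 p ↔ b p = true)

/-- The particle approximation `μ_b^N(φ)` (a function of the realization `ω = (ζ, A)`);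
the conditional expectation given `(A, ζ)` is the integral with respect to `kLaw`. -/
def muBN (G : ℕ → X → ℝ) (Np : ℕ → ℕ) (n : ℕ) (b : ℕ → Bool) (φ : X × X → ℝ)
    (ω : (ℕ → ℕ → X) × (ℕ → ℕ → ℕ)) : ℝ :=
  (∏ p ∈ Finset.range (n + 1),
      if b p then (Np p : ℝ) else (Np p : ℝ) / ((Np p : ℝ) - 1)) *
    gammaN G Np n 1 ω ^ 2 *
    ∫ k, (if inI Np n b k then (1 : ℝ) else 0) * φ (ω.1 n (k.1 n), ω.1 n (k.2 n))
      ∂(kLaw G Np n ω)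

/-- `v_{p,n}^N(φ)`. -/
def vpnN (G : ℕ → X → ℝ) (Np : ℕ → ℕ) (n p : ℕ) (φ : X → ℝ)
    (ω : (ℕ → ℕ → X) × (ℕ → ℕ → ℕ)) : ℝ :=
  (muBN G Np n (eVec p) (tens φ) ω - muBN G Np n zeroVec (tens φ) ω) / gammaN G Np n 1 ω ^ 2

/-- `v_n^N(φ) = Σ_{p=0}^n c_p⁻¹ v_{p,n}^N(φ)`. -/
def vnN (G : ℕ → X → ℝ) (Np : ℕ → ℕ) (c : ℕ → ℝ) (n : ℕ) (φ : X → ℝ)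
    (ω : (ℕ → ℕ → X) × (ℕ → ℕ → ℕ)) : ℝ :=
  ∑ p ∈ Finset.range (n + 1), (c p)⁻¹ * vpnN G Np n p φ ω

/-- `QAux M G n φ j = Q_{n-j,n}(φ)`. -/
def QAux (M : ℕ → Kernel X X) (G : ℕ → X → ℝ) (n : ℕ) (φ : X → ℝ) : ℕ → X → ℝ
  | 0 => φ
  | j + 1 => fun x => G (n - (j + 1)) x * ∫ y, QAux M G n φ j y ∂(M (n - j) x)

/-- `Q_{p,n}(φ)` where `Q_p(x, dx') = G_{p-1}(x) M_p(x, dx')`, `Q_{n,n} = Id`,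
`Q_{p,n} = Q_{p+1} ⋯ Q_n`. -/
def Qpn (M : ℕ → Kernel X X) (G : ℕ → X → ℝ) (n p : ℕ) (φ : X → ℝ) : X → ℝ :=
  QAux M G n φ (n - p)

/-- `φ̂ = G_n · φ`. -/
def hatf (G : ℕ → X → ℝ) (n : ℕ) (φ : X → ℝ) : X → ℝ := fun x => G n x * φ x

/-- `γ̂_n(φ) = γ_n(G_n φ)`. -/
def gHatInt (M0 : Measure X) (M : ℕ → Kernel X X) (G : ℕ → X → ℝ) (n : ℕ) (φ : X → ℝ) : ℝ :=
  gInt M0 M G n (hatf G n φ)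

/-- `η̂_n(φ) = γ̂_n(φ)/γ̂_n(1)`. -/
def eHatInt (M0 : Measure X) (M : ℕ → Kernel X X) (G : ℕ → X → ℝ) (n : ℕ) (φ : X → ℝ) : ℝ :=
  gHatInt M0 M G n φ / gHatInt M0 M G n 1

/-- `γ̂_n^N(φ) = γ_n^N(G_n φ)`. -/
def gammaHatN (G : ℕ → X → ℝ) (Np : ℕ → ℕ) (n : ℕ) (φ : X → ℝ)
    (ω : (ℕ → ℕ → X) × (ℕ → ℕ → ℕ)) : ℝ :=
  gammaN G Np n (hatf G n φ) ω

/-- `η̂_n^N(φ) = γ̂_n^N(φ)/γ̂_n^N(1)`. -/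
def etaHatN (G : ℕ → X → ℝ) (Np : ℕ → ℕ) (n : ℕ) (φ : X → ℝ)
    (ω : (ℕ → ℕ → X) × (ℕ → ℕ → ℕ)) : ℝ :=
  gammaHatN G Np n φ ω / gammaHatN G Np n 1 ω

/-- `v̂_{p,n}(φ) = v_{p,n}(φ̂)/η_n(G_n)²`. -/
def vpnHat (M0 : Measure X) (M : ℕ → Kernel X X) (G : ℕ → X → ℝ) (n p : ℕ) (φ : X → ℝ) : ℝ :=
  vpn M0 M G n p (hatf G n φ) / eInt M0 M G n (G n) ^ 2

/-- `σ̂_n²(φ) = Σ_{p=0}^n c_p⁻¹ v̂_{p,n}(φ)`. -/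
def sigma2Hat (M0 : Measure X) (M : ℕ → Kernel X X) (G : ℕ → X → ℝ) (c : ℕ → ℝ) (n : ℕ)
    (φ : X → ℝ) : ℝ :=
  ∑ p ∈ Finset.range (n + 1), (c p)⁻¹ * vpnHat M0 M G n p φ

/-- `V̂_n^N(φ) = V_n^N(φ̂)/η_n^N(G_n)²`. -/
def VestHat (G : ℕ → X → ℝ) (Np : ℕ → ℕ) (n : ℕ) (φ : X → ℝ)
    (ω : (ℕ → ℕ → X) × (ℕ → ℕ → ℕ)) : ℝ :=
  Vest Np n (hatf G n φ) ω / etaN Np n (G n) ω ^ 2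

/-- `v̂_{p,n}^N(φ) = v_{p,n}^N(φ̂)/η_n^N(G_n)²`. -/
def vpnHatN (G : ℕ → X → ℝ) (Np : ℕ → ℕ) (n p : ℕ) (φ : X → ℝ)
    (ω : (ℕ → ℕ → X) × (ℕ → ℕ → ℕ)) : ℝ :=
  vpnN G Np n p (hatf G n φ) ω / etaN Np n (G n) ω ^ 2

/-- `v̂_n^N(φ) = Σ_{p=0}^n c_p⁻¹ v̂_{p,n}^N(φ)`. -/
def vnHatN (G : ℕ → X → ℝ) (Np : ℕ → ℕ) (c : ℕ → ℝ) (n : ℕ) (φ : X → ℝ)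
    (ω : (ℕ → ℕ → X) × (ℕ → ℕ → ℕ)) : ℝ :=
  ∑ p ∈ Finset.range (n + 1), (c p)⁻¹ * vpnHatN G Np n p φ ω

set_option linter.unusedSectionVars false

/-! ### Bounded measurable functions -/

/-- Real functions that are measurable and bounded. -/
structure BddMeas {α : Type*} [MeasurableSpace α] (f : α → ℝ) : Prop where
  measurable : Measurable f
  bounded : ∃ C, ∀ x, |f x| ≤ C

namespace BddMeas

variable {α β : Type*} [MeasurableSpace α] [MeasurableSpace β] {f g : α → ℝ}

theorem const (c : ℝ) : BddMeas fun _ : α => c :=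
  ⟨measurable_const, |c|, fun _ => le_rfl⟩

theorem exists_pos (hf : BddMeas f) : ∃ C, 0 < C ∧ ∀ x, |f x| ≤ C := by
  obtain ⟨C, hC⟩ := hf.bounded
  exact ⟨max C 1, by positivity, fun x => (hC x).trans (le_max_left _ _)⟩

theorem add (hf : BddMeas f) (hg : BddMeas g) : BddMeas fun x => f x + g x := by
  obtain ⟨C, hC⟩ := hf.bounded
  obtain ⟨D, hD⟩ := hg.bounded
  exact ⟨hf.measurable.add hg.measurable, C + D,
    fun x => (abs_add_le _ _).trans (add_le_add (hC x) (hD x))⟩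

theorem mul (hf : BddMeas f) (hg : BddMeas g) : BddMeas fun x => f x * g x := by
  obtain ⟨C, hC, hfC⟩ := hf.exists_pos
  obtain ⟨D, hD, hgD⟩ := hg.exists_pos
  refine ⟨hf.measurable.mul hg.measurable, C * D, fun x => ?_⟩
  rw [abs_mul]
  exact mul_le_mul (hfC x) (hgD x) (abs_nonneg _) hC.le

theorem const_mul (c : ℝ) (hf : BddMeas f) : BddMeas fun x => c * f x := (const c).mul hf

theorem sub (hf : BddMeas f) (hg : BddMeas g) : BddMeas fun x => f x - g x := by
  simpa [sub_eq_add_neg] using hf.add (hg.const_mul (-1))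

theorem pow (hf : BddMeas f) (k : ℕ) : BddMeas fun x => f x ^ k := by
  induction k with
  | zero => simpa using const 1
  | succ k ih => simpa [pow_succ] using ih.mul hf

theorem sum {ι : Type*} (s : Finset ι) {F : ι → α → ℝ} (hF : ∀ i, BddMeas (F i)) :
    BddMeas fun x => ∑ i ∈ s, F i x := by
  induction s using Finset.induction_on with
  | empty => simpa using const 0
  | insert i s hi ih => simpa [Finset.sum_insert hi] using (hF i).add ih

theorem prod {ι : Type*} (s : Finset ι) {F : ι → α → ℝ} (hF : ∀ i ∈ s, BddMeas (F i)) :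
    BddMeas fun x => ∏ i ∈ s, F i x := by
  induction s using Finset.induction_on with
  | empty => simpa using const 1
  | insert i s hi ih =>
    simpa [Finset.prod_insert hi] using
      (hF i (by simp)).mul (ih fun j hj => hF j (by simp [hj]))

theorem comp (hf : BddMeas f) {u : β → α} (hu : Measurable u) : BddMeas fun x => f (u x) := by
  obtain ⟨C, hC⟩ := hf.bounded
  exact ⟨hf.measurable.comp hu, C, fun x => hC _⟩

theorem integrable (hf : BddMeas f) (μ : Measure α) [IsFiniteMeasure μ] : Integrable f μ := by
  obtain ⟨C, hC⟩ := hf.bounded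
  exact Integrable.of_bound hf.measurable.aestronglyMeasurable C (ae_of_all _ hC)

theorem abs_integral_le (μ : Measure α) [IsProbabilityMeasure μ] {C : ℝ}
    (hC : ∀ x, |f x| ≤ C) : |∫ x, f x ∂μ| ≤ C := by
  have h := norm_integral_le_of_norm_le_const (μ := μ) (f := f) (ae_of_all _ hC)
  simpa using h

theorem integral_kernel (κ : Kernel β α) [IsMarkovKernel κ] {F : β × α → ℝ} (hF : BddMeas F) :
    BddMeas fun b => ∫ a, F (b, a) ∂(κ b) := by
  obtain ⟨C, hC⟩ := hF.bounded
  exact ⟨(hF.measurable.stronglyMeasurable.integral_kernel_prod_right' (κ := κ)).measurable, C,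
    fun b => abs_integral_le _ fun a => hC _⟩

end BddMeas

/-! ### Composition of a measure with a kernel followed by a deterministic map -/

section BindMap

variable {A B C : Type*} [MeasurableSpace A] [MeasurableSpace B] [MeasurableSpace C]

theorem measurable_map_kernel (κ : Kernel A B) [IsSFiniteKernel κ] {u : A → B → C}
    (hu : Measurable (Function.uncurry u)) : Measurable fun a => (κ a).map (u a) := by
  have h : (fun a => (κ a).map (u a))
      = fun a => ((Kernel.id ×ₖ κ).map (Function.uncurry u)) a := by
    ext1 a
    rw [Kernel.map_apply _ hu, Kernel.prod_apply, Kernel.id_apply, Measure.dirac_prod,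
      Measure.map_map hu measurable_prodMk_left]
    rfl
  rw [h]
  exact Kernel.measurable _

theorem bind_map_eq (μ : Measure A) [IsProbabilityMeasure μ] (κ : Kernel A B) [IsMarkovKernel κ]
    {u : A → B → C} (hu : Measurable (Function.uncurry u)) :
    (μ.bind fun a => (κ a).map (u a)) = (μ ⊗ₘ κ).map (Function.uncurry u) := by
  ext s hs
  rw [Measure.bind_apply hs (measurable_map_kernel κ hu).aemeasurable, Measure.map_apply hu hs,
    Measure.compProd_apply (hu hs)]
  refine lintegral_congr fun a => ?_
  exact Measure.map_apply (hu.comp measurable_prodMk_left) hs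

theorem isProbabilityMeasure_bind_map (μ : Measure A) [IsProbabilityMeasure μ] (κ : Kernel A B)
    [IsMarkovKernel κ] {u : A → B → C} (hu : Measurable (Function.uncurry u)) :
    IsProbabilityMeasure (μ.bind fun a => (κ a).map (u a)) := by
  rw [bind_map_eq μ κ hu]
  exact Measure.isProbabilityMeasure_map hu.aemeasurable

theorem integral_bind_map (μ : Measure A) [IsProbabilityMeasure μ] (κ : Kernel A B)
    [IsMarkovKernel κ] {u : A → B → C} (hu : Measurable (Function.uncurry u)) {F : C → ℝ}
    (hF : BddMeas F) :
    ∫ c, F c ∂(μ.bind fun a => (κ a).map (u a)) = ∫ a, ∫ b, F (u a b) ∂(κ a) ∂μ := by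
  rw [bind_map_eq μ κ hu, integral_map hu.aemeasurable hF.measurable.aestronglyMeasurable,
    Measure.integral_compProd ((hF.comp hu).integrable _)]
  rfl

/-- The kernel sampling `m` conditionally independent draws from a Markov kernel. -/
def piKernel (κ : Kernel A B) [IsMarkovKernel κ] (m : ℕ) : Kernel A (Fin m → B) where
  toFun a := Measure.pi fun _ => κ a
  measurable' := by
    refine Measurable.measure_of_isPiSystem_of_isProbabilityMeasure generateFrom_pi.symm
      isPiSystem_pi ?_
    rintro _ ⟨s, hs, rfl⟩
    simp only [Measure.pi_pi]
    exact Finset.measurable_prod _ fun i _ => κ.measurable_coe (hs i (Set.mem_univ i))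

instance (κ : Kernel A B) [IsMarkovKernel κ] (m : ℕ) : IsMarkovKernel (piKernel κ m) :=
  ⟨fun a => inferInstanceAs (IsProbabilityMeasure (Measure.pi fun _ => κ a))⟩

end BindMap

/-! ### Second-order statistics of i.i.d. samples -/

section Pairs

variable {Y : Type*} [MeasurableSpace Y] (ν : Measure Y) [IsProbabilityMeasure ν] {m : ℕ}

theorem integral_pi_pair {i j : Fin m} (hij : i ≠ j) {h : Y × Y → ℝ} (hh : BddMeas h) :
    ∫ y, h (y i, y j) ∂(Measure.pi fun _ : Fin m => ν) = ∫ q, h q ∂(ν.prod ν) := by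
  have hind : IndepFun (fun y : Fin m → Y => y i) (fun y => y j) (Measure.pi fun _ => ν) :=
    (iIndepFun_pi (μ := fun _ : Fin m => ν) (X := fun _ => id)
      fun _ => aemeasurable_id).indepFun hij
  have hmap := (indepFun_iff_map_prod_eq_prod_map_map
    (measurable_pi_apply i).aemeasurable (measurable_pi_apply j).aemeasurable).1 hind
  rw [(measurePreserving_eval (fun _ : Fin m => ν) i).map_eq,
    (measurePreserving_eval (fun _ : Fin m => ν) j).map_eq] at hmap
  rw [← hmap, integral_map (by fun_prop) hh.measurable.aestronglyMeasurable]

theorem integral_pi_diag (i : Fin m) {h : Y × Y → ℝ} (hh : BddMeas h) :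
    ∫ y, h (y i, y i) ∂(Measure.pi fun _ : Fin m => ν) = ∫ x, h (x, x) ∂ν :=
  integral_comp_eval (μ := fun _ : Fin m => ν) (i := i) (f := fun x => h (x, x))
    (hh.comp (measurable_id.prodMk measurable_id)).measurable.aestronglyMeasurable

theorem integral_pi_sum_pairs {h : Y × Y → ℝ} (hh : BddMeas h) :
    ∫ y, ∑ i, ∑ j, h (y i, y j) ∂(Measure.pi fun _ : Fin m => ν)
      = m * ∫ x, h (x, x) ∂ν + m * (m - 1) * ∫ q, h q ∂(ν.prod ν) := by
  have hB : ∀ i j : Fin m, BddMeas fun y : Fin m → Y => h (y i, y j) := fun i j =>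
    hh.comp ((measurable_pi_apply i).prodMk (measurable_pi_apply j))
  rw [integral_finsetSum _ fun i _ => (BddMeas.sum _ fun j => hB i j).integrable _]
  have key : ∀ i : Fin m, ∫ y, ∑ j, h (y i, y j) ∂(Measure.pi fun _ : Fin m => ν)
      = ∫ x, h (x, x) ∂ν + (m - 1) * ∫ q, h q ∂(ν.prod ν) := by
    intro i
    rw [integral_finsetSum _ fun j _ => (hB i j).integrable _,
      ← Finset.add_sum_erase _ _ (Finset.mem_univ i), integral_pi_diag ν i hh,
      Finset.sum_congr rfl fun j hj =>
        integral_pi_pair ν (Finset.ne_of_mem_erase hj).symm hh]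
    have : 1 ≤ m := Nat.one_le_of_lt i.isLt
    simp [Finset.card_erase_of_mem, Nat.cast_sub this]
  simp only [key, Finset.sum_const, Finset.card_univ, Fintype.card_fin, nsmul_eq_mul]
  ring

theorem integral_pi_sum {f : Y → ℝ} (hf : BddMeas f) :
    ∫ y, ∑ i, f (y i) ∂(Measure.pi fun _ : Fin m => ν) = m * ∫ x, f x ∂ν := by
  rw [integral_finsetSum _ fun i _ => (hf.comp (measurable_pi_apply i)).integrable _]
  simp [integral_comp_eval (μ := fun _ : Fin m => ν) hf.measurable.aestronglyMeasurable]

theorem integral_pi_mul_pairs {i j k l : Fin m} (hik : i ≠ k) (hil : i ≠ l) (hjk : j ≠ k)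
    (hjl : j ≠ l) {h : Y × Y → ℝ} (hh : BddMeas h) :
    ∫ y, h (y i, y j) * h (y k, y l) ∂(Measure.pi fun _ : Fin m => ν)
      = (∫ y, h (y i, y j) ∂(Measure.pi fun _ : Fin m => ν))
        * ∫ y, h (y k, y l) ∂(Measure.pi fun _ : Fin m => ν) := by
  have hind := ((iIndepFun_pi (μ := fun _ : Fin m => ν) (X := fun _ => id)
    fun _ => aemeasurable_id).indepFun_prodMk_prodMk (fun i => measurable_pi_apply i)
      i j k l hik hil hjk hjl).comp hh.measurable hh.measurable
  exact hind.integral_fun_mul_eq_mul_integral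
    (hh.comp ((measurable_pi_apply i).prodMk (measurable_pi_apply j))).measurable.aestronglyMeasurable
    (hh.comp ((measurable_pi_apply k).prodMk (measurable_pi_apply l))).measurable.aestronglyMeasurable

/-- The integral of the squared deviation from the mean. -/
theorem integral_sq_dev {Ω : Type*} [MeasurableSpace Ω] (P : Measure Ω) [IsProbabilityMeasure P]
    {Z : Ω → ℝ} (hZ : BddMeas Z) :
    ∫ y, (Z y - ∫ y', Z y' ∂P) ^ 2 ∂P = ∫ y, Z y ^ 2 ∂P - (∫ y, Z y ∂P) ^ 2 := by
  set a := ∫ y, Z y ∂P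
  have h : ∀ y, (Z y - a) ^ 2 = Z y ^ 2 - 2 * a * Z y + a ^ 2 := fun y => by ring
  simp only [h]
  rw [integral_add (((hZ.pow 2).sub (hZ.const_mul _)).integrable P) (integrable_const _),
    integral_sub ((hZ.pow 2).integrable P) ((hZ.const_mul _).integrable P), integral_const_mul]
  simp
  ring

theorem sq_integral_le {Ω : Type*} [MeasurableSpace Ω] (P : Measure Ω) [IsProbabilityMeasure P]
    {Z : Ω → ℝ} (hZ : BddMeas Z) : (∫ y, Z y ∂P) ^ 2 ≤ ∫ y, Z y ^ 2 ∂P := by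
  have h : 0 ≤ ∫ y, (Z y - ∫ y', Z y' ∂P) ^ 2 ∂P := integral_nonneg fun y => sq_nonneg _
  rw [integral_sq_dev P hZ] at h
  linarith

section DoubleSum

variable {Ω : Type*} [MeasurableSpace Ω] (P : Measure Ω) [IsProbabilityMeasure P]
  {ι : Type*} [Fintype ι]

theorem sum_overlap (B : ι → ι → ι → ι → ℝ) :
    ∑ i, ∑ j, ∑ k, ∑ l, ((if i = k then 1 else 0) + (if i = l then 1 else 0)
        + (if j = k then 1 else 0) + (if j = l then 1 else 0)) * B i j k l
      = ∑ i, ∑ j, ∑ l, (B i j i l + B i j l i + B j i i l + B j i l i) := by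
  simp only [add_mul, ite_mul, one_mul, zero_mul, Finset.sum_add_distrib, Finset.sum_ite_eq,
    Finset.mem_univ, if_true]
  have h1 : ∀ i j, ∑ k, ∑ l, (if i = k then B i j k l else 0) = ∑ l, B i j i l := fun i j => by
    rw [Finset.sum_comm]; simp
  have h2 : ∀ i j, ∑ k, ∑ l, (if j = k then B i j k l else 0) = ∑ l, B i j j l := fun i j => by
    rw [Finset.sum_comm]; simp
  simp only [h1, h2]
  rw [Finset.sum_comm (f := fun i j => ∑ l, B i j j l),
    Finset.sum_comm (f := fun i j => ∑ l, B i j l j)]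

theorem sq_double_sum (a : ι → ι → ℝ) :
    (∑ i, ∑ j, a i j) ^ 2 = ∑ i, ∑ j, ∑ k, ∑ l, a i j * a k l := by
  rw [sq, Finset.sum_mul]
  refine Finset.sum_congr rfl fun i _ => ?_
  rw [Finset.sum_mul]
  refine Finset.sum_congr rfl fun j _ => ?_
  rw [Finset.mul_sum]
  exact Finset.sum_congr rfl fun k _ => Finset.mul_sum _ _ _

/-- The class sizes `n i = ∑ j, D i j` of a relation-like kernel satisfy
`2 ∑ i, n i ^ 2 ≤ δ T ^ 2 + T / δ` with `T = ∑ i, n i`. -/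
theorem two_mul_sum_sq_le {D : ι → ι → ℝ} (hD0 : ∀ i j, 0 ≤ D i j)
    (hmul : ∀ i j l, D i j * D i l ≤ D j l) {δ : ℝ} (hδ : 0 < δ) :
    2 * ∑ i, (∑ j, D i j) ^ 2 ≤ δ * (∑ i, ∑ j, D i j) ^ 2 + δ⁻¹ * ∑ i, ∑ j, D i j := by
  set T := ∑ i, ∑ j, D i j with hT
  have hsq : ∀ i, (∑ j, D i j) ^ 2 ≤ T := fun i => by
    rw [sq, Finset.sum_mul_sum, hT]
    exact Finset.sum_le_sum fun j _ => Finset.sum_le_sum fun l _ => hmul i j l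
  have hn0 : ∀ i, 0 ≤ ∑ j, D i j := fun i => Finset.sum_nonneg fun j _ => hD0 i j
  have hlin : ∀ i, 2 * ∑ j, D i j ≤ δ * T + δ⁻¹ := fun i => by
    have h1 := hsq i
    have h2 := mul_nonneg hδ.le (sq_nonneg (∑ j, D i j - δ⁻¹))
    have h3 : δ * δ⁻¹ = 1 := mul_inv_cancel₀ hδ.ne'
    have h4 : δ * (∑ j, D i j - δ⁻¹) ^ 2
        = δ * (∑ j, D i j) ^ 2 - 2 * (δ * δ⁻¹) * (∑ j, D i j) + (δ * δ⁻¹) * δ⁻¹ := by ring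
    rw [h4, h3] at h2
    nlinarith [mul_le_mul_of_nonneg_left h1 hδ.le]
  calc 2 * ∑ i, (∑ j, D i j) ^ 2 = ∑ i, (2 * ∑ j, D i j) * ∑ j, D i j := by
        rw [Finset.mul_sum]; exact Finset.sum_congr rfl fun i _ => by ring
    _ ≤ ∑ i, (δ * T + δ⁻¹) * ∑ j, D i j :=
        Finset.sum_le_sum fun i _ => mul_le_mul_of_nonneg_right (hlin i) (hn0 i)
    _ = δ * T ^ 2 + δ⁻¹ * T := by rw [← Finset.mul_sum, ← hT]; ring

/-- Variance bound for a double sum whose terms with disjoint index pairs are uncorrelated. -/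
theorem integral_sq_dev_double_sum_le {H D : ι → ι → Ω → ℝ} (hH : ∀ i j, BddMeas (H i j))
    (hD : ∀ i j, BddMeas (D i j)) {C : ℝ} (hC : 0 ≤ C) (hHD : ∀ i j y, |H i j y| ≤ C * D i j y)
    (hD0 : ∀ i j y, 0 ≤ D i j y) (hsymm : ∀ i j, D i j = D j i)
    (hmul : ∀ i j l y, D i j y * D i l y ≤ D j l y)
    (hind : ∀ i j k l, i ≠ k → i ≠ l → j ≠ k → j ≠ l →
      ∫ y, H i j y * H k l y ∂P = (∫ y, H i j y ∂P) * ∫ y, H k l y ∂P) {δ : ℝ} (hδ : 0 < δ) :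
    ∫ y, (∑ i, ∑ j, H i j y - ∫ y', ∑ i, ∑ j, H i j y' ∂P) ^ 2 ∂P
      ≤ 4 * C ^ 2 * (δ * ∫ y, (∑ i, ∑ j, D i j y) ^ 2 ∂P
          + δ⁻¹ * ∫ y, ∑ i, ∑ j, D i j y ∂P) := by
  have hHs : BddMeas fun y => ∑ i, ∑ j, H i j y := .sum _ fun i => .sum _ fun j => hH i j
  have hDs : BddMeas fun y => ∑ i, ∑ j, D i j y := .sum _ fun i => .sum _ fun j => hD i j
  set B : ι → ι → ι → ι → ℝ := fun i j k l =>
    ∫ y, D i j y * D k l y ∂P + (∫ y, D i j y ∂P) * ∫ y, D k l y ∂P with hB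
  have hB0 : ∀ i j k l, 0 ≤ B i j k l := fun i j k l => add_nonneg
    (integral_nonneg fun y => mul_nonneg (hD0 _ _ _) (hD0 _ _ _))
    (mul_nonneg (integral_nonneg (hD0 _ _)) (integral_nonneg (hD0 _ _)))
  have habs : ∀ i j, |∫ y, H i j y ∂P| ≤ C * ∫ y, D i j y ∂P := fun i j => by
    rw [← integral_const_mul]
    exact (abs_integral_le_integral_abs).trans (integral_mono ((hH i j).integrable P).abs
      (((hD i j).const_mul C).integrable P) (hHD i j))
  have hterm : ∀ i j k l, ∫ y, H i j y * H k l y ∂P - (∫ y, H i j y ∂P) * ∫ y, H k l y ∂P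
      ≤ ((if i = k then 1 else 0) + (if i = l then 1 else 0)
        + (if j = k then 1 else 0) + (if j = l then 1 else 0)) * (C ^ 2 * B i j k l) := by
    intro i j k l
    have hnn := mul_nonneg (sq_nonneg C) (hB0 i j k l)
    by_cases hdis : i ≠ k ∧ i ≠ l ∧ j ≠ k ∧ j ≠ l
    · obtain ⟨h1, h2, h3, h4⟩ := hdis
      rw [hind i j k l h1 h2 h3 h4]
      simp [h1, h2, h3, h4]
    · have h1 : ∫ y, H i j y * H k l y ∂P ≤ C ^ 2 * ∫ y, D i j y * D k l y ∂P := by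
        rw [← integral_const_mul]
        refine integral_mono (((hH i j).mul (hH k l)).integrable P)
          ((((hD i j).mul (hD k l)).const_mul _).integrable P) fun y => ?_
        calc H i j y * H k l y ≤ |H i j y| * |H k l y| := by rw [← abs_mul]; exact le_abs_self _
          _ ≤ (C * D i j y) * (C * D k l y) := mul_le_mul (hHD _ _ _) (hHD _ _ _) (abs_nonneg _)
              (mul_nonneg hC (hD0 _ _ _))
          _ = C ^ 2 * (D i j y * D k l y) := by ring
      have h2 : -((∫ y, H i j y ∂P) * ∫ y, H k l y ∂P)
          ≤ C ^ 2 * ((∫ y, D i j y ∂P) * ∫ y, D k l y ∂P) := by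
        calc _ ≤ |∫ y, H i j y ∂P| * |∫ y, H k l y ∂P| := by rw [← abs_mul]; exact neg_le_abs _
          _ ≤ (C * ∫ y, D i j y ∂P) * (C * ∫ y, D k l y ∂P) := mul_le_mul (habs _ _) (habs _ _)
              (abs_nonneg _) (mul_nonneg hC (integral_nonneg (hD0 _ _)))
          _ = _ := by ring
      have h3 : (1 : ℝ) ≤ (if i = k then 1 else 0) + (if i = l then 1 else 0)
          + (if j = k then 1 else 0) + (if j = l then 1 else 0) := by
        rcases (by tauto : i = k ∨ i = l ∨ j = k ∨ j = l) with h | h | h | h <;>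
          simp only [h, if_true] <;> split_ifs <;> norm_num
      have h4 := mul_le_mul_of_nonneg_right h3 hnn
      simp only [hB] at h4 ⊢
      linarith
  have hvar : ∫ y, (∑ i, ∑ j, H i j y - ∫ y', ∑ i, ∑ j, H i j y' ∂P) ^ 2 ∂P
      = ∑ i, ∑ j, ∑ k, ∑ l,
        (∫ y, H i j y * H k l y ∂P - (∫ y, H i j y ∂P) * ∫ y, H k l y ∂P) := by
    rw [integral_sq_dev P hHs]
    simp only [Finset.sum_sub_distrib]
    congr 1
    · simp only [sq_double_sum]
      rw [integral_finsetSum _ fun i _ => (BddMeas.sum _ fun j => BddMeas.sum _ fun k =>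
        BddMeas.sum _ fun l => (hH i j).mul (hH k l)).integrable P]
      refine Finset.sum_congr rfl fun i _ => ?_
      rw [integral_finsetSum _ fun j _ => (BddMeas.sum _ fun k =>
        BddMeas.sum _ fun l => (hH i j).mul (hH k l)).integrable P]
      refine Finset.sum_congr rfl fun j _ => ?_
      rw [integral_finsetSum _ fun k _ =>
        (BddMeas.sum _ fun l => (hH i j).mul (hH k l)).integrable P]
      refine Finset.sum_congr rfl fun k _ => ?_
      rw [integral_finsetSum _ fun l _ => ((hH i j).mul (hH k l)).integrable P]
    · have hs : ∫ y, ∑ i, ∑ j, H i j y ∂P = ∑ i, ∑ j, ∫ y, H i j y ∂P := by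
        rw [integral_finsetSum _ fun i _ => (BddMeas.sum _ fun j => hH i j).integrable P]
        exact Finset.sum_congr rfl fun i _ =>
          integral_finsetSum _ fun j _ => (hH i j).integrable P
      rw [hs, sq_double_sum]
  have hBsymm : ∀ i j l, B i j l i = B i j i l ∧ B j i i l = B i j i l ∧ B j i l i = B i j i l :=
    fun i j l => ⟨by simp only [hB, hsymm l i], by simp only [hB, hsymm j i],
      by simp only [hB, hsymm l i, hsymm j i]⟩
  have hrow : ∀ i, ∑ j, ∑ l, B i j i l ≤ 2 * ∫ y, (∑ j, D i j y) ^ 2 ∂P := by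
    intro i
    have hb : BddMeas fun y => ∑ j, D i j y := .sum _ fun j => hD i j
    have e1 : ∑ j, ∑ l, ∫ y, D i j y * D i l y ∂P = ∫ y, (∑ j, D i j y) ^ 2 ∂P := by
      simp only [sq, Finset.sum_mul_sum]
      rw [integral_finsetSum _ fun j _ =>
        (BddMeas.sum _ fun l => (hD i j).mul (hD i l)).integrable P]
      exact Finset.sum_congr rfl fun j _ =>
        (integral_finsetSum _ fun l _ => ((hD i j).mul (hD i l)).integrable P).symm
    have e2 : ∑ j, ∑ l, (∫ y, D i j y ∂P) * ∫ y, D i l y ∂P = (∫ y, ∑ j, D i j y ∂P) ^ 2 := by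
      rw [integral_finsetSum _ fun j _ => (hD i j).integrable P, sq, Finset.sum_mul_sum]
    simp only [hB, Finset.sum_add_distrib]
    rw [e1, e2]
    linarith [sq_integral_le P hb]
  rw [hvar]
  calc _ ≤ ∑ i, ∑ j, ∑ k, ∑ l, ((if i = k then 1 else 0) + (if i = l then 1 else 0)
        + (if j = k then 1 else 0) + (if j = l then 1 else 0)) * (C ^ 2 * B i j k l) :=
        Finset.sum_le_sum fun i _ => Finset.sum_le_sum fun j _ => Finset.sum_le_sum fun k _ =>
          Finset.sum_le_sum fun l _ => hterm i j k l
    _ = 4 * C ^ 2 * ∑ i, ∑ j, ∑ l, B i j i l := by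
        rw [sum_overlap]
        simp only [hBsymm, Finset.mul_sum]
        exact Finset.sum_congr rfl fun i _ => Finset.sum_congr rfl fun j _ =>
          Finset.sum_congr rfl fun l _ => by ring
    _ ≤ 4 * C ^ 2 * ∑ i, 2 * ∫ y, (∑ j, D i j y) ^ 2 ∂P := by
        gcongr with i
        exact hrow i
    _ = 4 * C ^ 2 * ∫ y, 2 * ∑ i, (∑ j, D i j y) ^ 2 ∂P := by
        rw [integral_const_mul, integral_finsetSum _ fun i _ =>
          ((BddMeas.sum _ fun j => hD i j).pow 2).integrable P, ← Finset.mul_sum]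
    _ ≤ 4 * C ^ 2 * ∫ y, (δ * (∑ i, ∑ j, D i j y) ^ 2 + δ⁻¹ * ∑ i, ∑ j, D i j y) ∂P := by
        refine mul_le_mul_of_nonneg_left ?_ (by positivity)
        refine integral_mono ?_ ?_ fun y =>
          two_mul_sum_sq_le (fun i j => hD0 i j y) (fun i j l => hmul i j l y) hδ
        · exact ((BddMeas.sum _ fun i =>
            (BddMeas.sum _ fun j => hD i j).pow 2).const_mul 2).integrable P
        · exact (((hDs.pow 2).const_mul δ).add (hDs.const_mul _)).integrable P
    _ = _ := by
        rw [integral_add (((hDs.pow 2).const_mul δ).integrable P)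
          ((hDs.const_mul _).integrable P), integral_const_mul, integral_const_mul]

end DoubleSum
end Pairs

/-! ### One step of the particle filter -/

/-- Potential functions: bounded, measurable and strictly positive. -/
structure IsPotential (g : X → ℝ) : Prop extends BddMeas g where
  pos : ∀ x, 0 < g x

/-- The law of the ancestor index and position of one particle of generation `p + 1`. -/
def oneStep (M : ℕ → Kernel X X) (G : ℕ → X → ℝ) (Np : ℕ → ℕ) (p : ℕ) (z : ℕ → X) :
    Measure (ℕ × X) :=
  (cat (Np p) fun j => G p (z j)).bind fun a => (M (p + 1) (z a)).map fun x => (a, x)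

/-- `Q_{k+1}(f)(x) = G_k(x) M_{k+1}(f)(x)`. -/
def qOp (M : ℕ → Kernel X X) (G : ℕ → X → ℝ) (k : ℕ) (f : X → ℝ) : X → ℝ :=
  fun x => G k x * ∫ y, f y ∂(M (k + 1) x)

section OneStep

variable (M : ℕ → Kernel X X) [∀ p, IsMarkovKernel (M p)] (G : ℕ → X → ℝ) (Np : ℕ → ℕ) (p : ℕ)

theorem oneStep_apply (z : ℕ → X) {s : Set (ℕ × X)} (hs : MeasurableSet s) :
    oneStep M G Np p z s = (∑ j ∈ Finset.range (Np p), ENNReal.ofReal (G p (z j)))⁻¹ *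
      ∑ j ∈ Finset.range (Np p),
        ENNReal.ofReal (G p (z j)) * M (p + 1) (z j) (Prod.mk j ⁻¹' s) := by
  rw [oneStep, Measure.bind_apply hs (Measurable.of_discrete).aemeasurable, cat]
  simp only [lintegral_smul_measure, lintegral_finsetSum_measure, lintegral_dirac, smul_eq_mul,
    Measure.map_apply measurable_prodMk_left hs]

theorem oneStep_eq (z : ℕ → X) :
    oneStep M G Np p z = (∑ j ∈ Finset.range (Np p), ENNReal.ofReal (G p (z j)))⁻¹ •
      ∑ j ∈ Finset.range (Np p),
        ENNReal.ofReal (G p (z j)) • (M (p + 1) (z j)).map (Prod.mk j) := by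
  ext s hs
  rw [oneStep_apply M G Np p z hs]
  simp [Measure.map_apply measurable_prodMk_left hs]

variable {G Np p}

theorem sum_potential_pos (hG : IsPotential (G p)) (hN : 1 ≤ Np p) (z : ℕ → X) :
    0 < ∑ j ∈ Finset.range (Np p), G p (z j) :=
  Finset.sum_pos (fun _ _ => hG.pos _) ⟨0, Finset.mem_range.2 hN⟩

theorem isProbabilityMeasure_oneStep (hG : IsPotential (G p)) (hN : 1 ≤ Np p) (z : ℕ → X) :
    IsProbabilityMeasure (oneStep M G Np p z) := by
  constructor
  rw [oneStep_apply M G Np p z MeasurableSet.univ]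
  simp only [Set.preimage_univ, measure_univ, mul_one]
  rw [← ENNReal.ofReal_sum_of_nonneg fun _ _ => (hG.pos _).le]
  exact ENNReal.inv_mul_cancel (by simpa using sum_potential_pos hG hN z) ENNReal.ofReal_ne_top

theorem measurable_oneStep (hG : IsPotential (G p)) : Measurable (oneStep M G Np p) := by
  refine Measure.measurable_of_measurable_coe _ fun s hs => ?_
  simp only [oneStep_apply M G Np p _ hs]
  have h1 : ∀ j : ℕ, Measurable fun z : ℕ → X => ENNReal.ofReal (G p (z j)) := fun j =>
    (hG.measurable.comp (measurable_pi_apply j)).ennreal_ofReal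
  refine (Finset.measurable_sum _ fun j _ => h1 j).inv.mul
    (Finset.measurable_sum _ fun j _ => (h1 j).mul ?_)
  exact ((M (p + 1)).measurable_coe (measurable_prodMk_left hs)).comp (measurable_pi_apply j)

theorem integral_oneStep (hG : IsPotential (G p)) (z : ℕ → X) {F : ℕ × X → ℝ}
    (hF : BddMeas F) :
    ∫ q, F q ∂(oneStep M G Np p z) = (∑ j ∈ Finset.range (Np p), G p (z j))⁻¹ *
      ∑ j ∈ Finset.range (Np p), G p (z j) * ∫ x, F (j, x) ∂(M (p + 1) (z j)) := by
  have hi : ∀ j, Integrable F ((M (p + 1) (z j)).map (Prod.mk j)) := fun j =>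
    (integrable_map_measure hF.measurable.aestronglyMeasurable
      measurable_prodMk_left.aemeasurable).2 ((hF.comp measurable_prodMk_left).integrable _)
  rw [oneStep_eq, integral_smul_measure, integral_finsetSum_measure fun j _ =>
    (hi j).smul_measure ENNReal.ofReal_ne_top,
    ← ENNReal.ofReal_sum_of_nonneg fun j _ => (hG.pos _).le, ENNReal.toReal_inv,
    ENNReal.toReal_ofReal (Finset.sum_nonneg fun j _ => (hG.pos _).le), smul_eq_mul]
  congr 1
  refine Finset.sum_congr rfl fun j _ => ?_
  rw [integral_smul_measure, ENNReal.toReal_ofReal (hG.pos _).le, smul_eq_mul,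
    integral_map measurable_prodMk_left.aemeasurable hF.measurable.aestronglyMeasurable]

theorem BddMeas.qOp {f : X → ℝ} (hG : BddMeas (G p)) (hf : BddMeas f) :
    BddMeas (qOp M G p f) :=
  hG.mul (BddMeas.integral_kernel (M (p + 1)) (hf.comp measurable_snd))

end OneStep

/-! ### The particle system as an iterated kernel -/

/-- The state space of the particle system. -/
abbrev PState (X : Type*) := (ℕ → ℕ → X) × (ℕ → ℕ → ℕ)

/-- The kernel generating the ancestor index and position of a particle of generation `p + 1`. -/
def stepKernel (M : ℕ → Kernel X X) [∀ p, IsMarkovKernel (M p)] {G : ℕ → X → ℝ} (Np : ℕ → ℕ)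
    {p : ℕ} (hG : IsPotential (G p)) : Kernel (PState X) (ℕ × X) where
  toFun ω := oneStep M G Np p (ω.1 p)
  measurable' := (measurable_oneStep M hG).comp ((measurable_pi_apply p).comp measurable_fst)

theorem isMarkovKernel_stepKernel (M : ℕ → Kernel X X) [∀ p, IsMarkovKernel (M p)]
    {G : ℕ → X → ℝ} {Np : ℕ → ℕ} {p : ℕ} (hG : IsPotential (G p)) (hN : 1 ≤ Np p) :
    IsMarkovKernel (stepKernel M Np hG) :=
  ⟨fun _ => isProbabilityMeasure_oneStep M hG hN _⟩

theorem measurable_padF {Y : Type*} [Nonempty Y] [MeasurableSpace Y] {m : ℕ} :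
    Measurable (padF : (Fin m → Y) → ℕ → Y) := by
  refine measurable_pi_iff.2 fun i => ?_
  by_cases h : i < m
  · simp only [padF, h, dif_pos]
    exact measurable_pi_apply _
  · simp only [padF, h, dif_neg, not_false_eq_true]
    exact measurable_const

section State

variable [Nonempty X]

/-- Append generation `k + 1` to the particle system. -/
def pfUpdate (k m : ℕ) (ω : PState X) (y : Fin m → ℕ × X) : PState X :=
  (Function.update ω.1 (k + 1) (padF fun i => (y i).2),
    Function.update ω.2 k (padF fun i => (y i).1))

theorem measurable_pfUpdate (k m : ℕ) :
    Measurable (Function.uncurry (pfUpdate (X := X) k m)) := by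
  have h1 : Measurable fun q : PState X × (Fin m → ℕ × X) => (padF fun i => (q.2 i).2 : ℕ → X) :=
    measurable_padF.comp (measurable_pi_iff.2 fun i =>
      measurable_snd.comp ((measurable_pi_apply i).comp measurable_snd))
  have h2 : Measurable fun q : PState X × (Fin m → ℕ × X) => (padF fun i => (q.2 i).1 : ℕ → ℕ) :=
    measurable_padF.comp (measurable_pi_iff.2 fun i =>
      measurable_fst.comp ((measurable_pi_apply i).comp measurable_snd))
  exact (measurable_update'.comp ((measurable_fst.comp measurable_fst).prodMk h1)).prodMk
    (measurable_update'.comp ((measurable_snd.comp measurable_fst).prodMk h2))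

section Law

variable (M0 : Measure X) [IsProbabilityMeasure M0] (M : ℕ → Kernel X X)
  [∀ p, IsMarkovKernel (M p)] {G : ℕ → X → ℝ} {Np : ℕ → ℕ} {k : ℕ}

theorem pfLaw_succ (hG : IsPotential (G k)) [IsMarkovKernel (stepKernel M Np hG)] :
    pfLaw M0 M G Np (k + 1) = (pfLaw M0 M G Np k).bind fun ω =>
      (piKernel (stepKernel M Np hG) (Np (k + 1)) ω).map (pfUpdate k (Np (k + 1)) ω) := by
  rw [pfLaw]
  congr 1
  funext ω
  have h1 : Measurable fun f : Fin (Np (k + 1)) → ℕ × X =>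
      ((padF fun i => (f i).1 : ℕ → ℕ), (padF fun i => (f i).2 : ℕ → X)) :=
    (measurable_padF.comp (measurable_pi_iff.2 fun i =>
      measurable_fst.comp (measurable_pi_apply i))).prodMk
    (measurable_padF.comp (measurable_pi_iff.2 fun i =>
      measurable_snd.comp (measurable_pi_apply i)))
  have h2 : Measurable fun az : (ℕ → ℕ) × (ℕ → X) =>
      ((Function.update ω.1 (k + 1) az.2, Function.update ω.2 k az.1) : PState X) :=
    ((measurable_update ω.1).comp measurable_snd).prodMk
      ((measurable_update ω.2).comp measurable_fst)
  rw [pfStep, Measure.map_map h2 h1]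
  rfl

theorem measurable_pfInit (m : ℕ) : Measurable fun f : Fin m → X =>
    ((fun p => if p = 0 then padF f else fun _ => Classical.arbitrary X, fun _ _ => 0) :
      PState X) := by
  refine Measurable.prodMk (measurable_pi_iff.2 fun p => ?_) measurable_const
  by_cases hp : p = 0
  · simpa [hp] using measurable_padF
  · simp [hp]

theorem isProbabilityMeasure_pfLaw (hG : ∀ p < k, IsPotential (G p)) (hN : ∀ p < k, 1 ≤ Np p) :
    IsProbabilityMeasure (pfLaw M0 M G Np k) := by
  induction k with
  | zero => exact Measure.isProbabilityMeasure_map (measurable_pfInit _).aemeasurable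
  | succ k ih =>
    have hk := k.lt_succ_self
    have := ih (fun p hp => hG p (hp.trans hk)) fun p hp => hN p (hp.trans hk)
    have := isMarkovKernel_stepKernel M (hG k hk) (hN k hk)
    rw [pfLaw_succ M0 M (hG k hk)]
    exact isProbabilityMeasure_bind_map _ _ (measurable_pfUpdate k _)

theorem integral_pfLaw_zero {F : PState X → ℝ} (hF : BddMeas F) :
    ∫ ω, F ω ∂(pfLaw M0 M G Np 0) = ∫ f : Fin (Np 0) → X,
      F (fun p => if p = 0 then padF f else fun _ => Classical.arbitrary X, fun _ _ => 0)
        ∂(Measure.pi fun _ => M0) := by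
  rw [pfLaw, integral_map (measurable_pfInit _).aemeasurable hF.measurable.aestronglyMeasurable]

theorem integral_pfLaw_succ (hG : ∀ p < k + 1, IsPotential (G p))
    (hN : ∀ p < k + 1, 1 ≤ Np p) {F : PState X → ℝ} (hF : BddMeas F) :
    ∫ ω, F ω ∂(pfLaw M0 M G Np (k + 1)) = ∫ ω, ∫ y, F (pfUpdate k (Np (k + 1)) ω y)
      ∂(Measure.pi fun _ => oneStep M G Np k (ω.1 k)) ∂(pfLaw M0 M G Np k) := by
  have hk := k.lt_succ_self
  have := isProbabilityMeasure_pfLaw M0 M (fun p hp => hG p (hp.trans hk))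
    fun p hp => hN p (hp.trans hk)
  have := isMarkovKernel_stepKernel M (hG k hk) (hN k hk)
  rw [pfLaw_succ M0 M (hG k hk), integral_bind_map _ _ (measurable_pfUpdate k _) hF]
  rfl

end Law

end State

/-! ### Particle statistics and their one-step conditional moments -/

/-- The normalizing constant `∏_{q < p} η_q^N(G_q)`. -/
def normC (G : ℕ → X → ℝ) (Np : ℕ → ℕ) (p : ℕ) (ω : PState X) : ℝ :=
  ∏ q ∈ Finset.range p, etaN Np q (G q) ω

/-- The V-statistic `N_p⁻² ∑_{i,j} r(E_p^i, E_p^j) f(ζ_p^i) g(ζ_p^j)`. -/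
def pairStat (r : ℕ → ℕ → ℝ) (Np : ℕ → ℕ) (p : ℕ) (f g : X → ℝ) (ω : PState X) : ℝ :=
  (Np p : ℝ)⁻¹ ^ 2 * ∑ i ∈ Finset.range (Np p), ∑ j ∈ Finset.range (Np p),
    r (eve ω.2 p i) (eve ω.2 p j) * (f (ω.1 p i) * g (ω.1 p j))

/-- The V-statistic `pairStat` multiplied by the squared normalizing constant. -/
def wStat (r : ℕ → ℕ → ℝ) (G : ℕ → X → ℝ) (Np : ℕ → ℕ) (p : ℕ) (f g : X → ℝ)
    (ω : PState X) : ℝ :=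
  normC G Np p ω ^ 2 * pairStat r Np p f g ω

/-- The function of two (ancestor, position) pairs underlying `pairStat`. -/
def pairFun (r : ℕ → ℕ → ℝ) (E : ℕ → ℕ) (f g : X → ℝ) (q : (ℕ × X) × (ℕ × X)) : ℝ :=
  r (E q.1.1) (E q.2.1) * (f q.1.2 * g q.2.2)

theorem normC_succ (G : ℕ → X → ℝ) (Np : ℕ → ℕ) (p : ℕ) (ω : PState X) :
    normC G Np (p + 1) ω = gammaN G Np p (G p) ω := by
  rw [normC, Finset.prod_range_succ, gammaN]

theorem gammaN_eq (G : ℕ → X → ℝ) (Np : ℕ → ℕ) (p : ℕ) (f : X → ℝ) (ω : PState X) :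
    gammaN G Np p f ω = normC G Np p ω * etaN Np p f ω := rfl

theorem measurable_eve (p i : ℕ) : Measurable fun A : ℕ → ℕ → ℕ => eve A p i := by
  induction p generalizing i with
  | zero => exact measurable_const
  | succ p ih =>
    have h : Measurable fun q : (ℕ → ℕ → ℕ) × ℕ => eve q.1 p q.2 :=
      measurable_from_prod_countable_left fun j => ih j
    exact h.comp (measurable_id.prodMk ((measurable_pi_apply i).comp (measurable_pi_apply p)))

section Bdd

variable {G : ℕ → X → ℝ} {Np : ℕ → ℕ} {p : ℕ} {r : ℕ → ℕ → ℝ} {f g : X → ℝ}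

theorem measurable_particle (p i : ℕ) : Measurable fun ω : PState X => ω.1 p i :=
  (measurable_pi_apply i).comp ((measurable_pi_apply p).comp measurable_fst)

theorem bddMeas_etaN (hf : BddMeas f) : BddMeas (etaN Np p f) :=
  (BddMeas.sum _ fun i => hf.comp (measurable_particle p i)).const_mul _

theorem bddMeas_normC (hG : ∀ q < p, IsPotential (G q)) : BddMeas (normC G Np p) :=
  BddMeas.prod _ fun q hq => bddMeas_etaN (hG q (Finset.mem_range.1 hq)).toBddMeas

theorem bddMeas_gammaN (hG : ∀ q < p, IsPotential (G q)) (hf : BddMeas f) :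
    BddMeas (gammaN G Np p f) :=
  (bddMeas_normC hG).mul (bddMeas_etaN hf)

theorem bddMeas_coupling {α : Type*} [MeasurableSpace α] (hr : ∀ a b, |r a b| ≤ 1) {u v : α → ℕ}
    (hu : Measurable u) (hv : Measurable v) : BddMeas fun x => r (u x) (v x) :=
  ⟨(Measurable.of_discrete (f := fun q : ℕ × ℕ => r q.1 q.2)).comp (hu.prodMk hv), 1,
    fun _ => hr _ _⟩

theorem bddMeas_pairStat (hr : ∀ a b, |r a b| ≤ 1) (hf : BddMeas f) (hg : BddMeas g) :
    BddMeas (pairStat r Np p f g) :=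
  (BddMeas.sum _ fun i => BddMeas.sum _ fun j =>
    (bddMeas_coupling hr ((measurable_eve p i).comp measurable_snd)
      ((measurable_eve p j).comp measurable_snd)).mul
    ((hf.comp (measurable_particle p i)).mul (hg.comp (measurable_particle p j)))).const_mul _

theorem bddMeas_wStat (hr : ∀ a b, |r a b| ≤ 1) (hG : ∀ q < p, IsPotential (G q))
    (hf : BddMeas f) (hg : BddMeas g) : BddMeas (wStat r G Np p f g) :=
  ((bddMeas_normC hG).pow 2).mul (bddMeas_pairStat hr hf hg)

theorem bddMeas_pairFun (hr : ∀ a b, |r a b| ≤ 1) (E : ℕ → ℕ) (hf : BddMeas f)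
    (hg : BddMeas g) : BddMeas (pairFun r E f g) :=
  (bddMeas_coupling hr
    ((Measurable.of_discrete (f := E)).comp (measurable_fst.comp measurable_fst))
    ((Measurable.of_discrete (f := E)).comp (measurable_fst.comp measurable_snd))).mul
  ((hf.comp (measurable_snd.comp measurable_fst)).mul
    (hg.comp (measurable_snd.comp measurable_snd)))

theorem etaN_pos (hG : IsPotential g) (hN : 1 ≤ Np p) (ω : PState X) : 0 < etaN Np p g ω :=
  mul_pos (by positivity) (Finset.sum_pos (fun _ _ => hG.pos _) ⟨0, Finset.mem_range.2 hN⟩)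

theorem abs_etaN_le {C : ℝ} (hN : 1 ≤ Np p) (hf : ∀ x, |f x| ≤ C) (ω : PState X) :
    |etaN Np p f ω| ≤ C := by
  have hN' : (0 : ℝ) < Np p := by exact_mod_cast hN
  rw [etaN, abs_mul, abs_inv, Nat.abs_cast, inv_mul_le_iff₀ hN']
  refine (Finset.abs_sum_le_sum_abs _ _).trans ((Finset.sum_le_sum fun i _ => hf _).trans ?_)
  simp

end Bdd

section Update

variable [Nonempty X] {G : ℕ → X → ℝ} {Np : ℕ → ℕ} {k : ℕ} {r : ℕ → ℕ → ℝ} {f g : X → ℝ}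

theorem pfUpdate_fst_of_le {m q : ℕ} (hq : q ≤ k) (ω : PState X) (y : Fin m → ℕ × X) :
    (pfUpdate k m ω y).1 q = ω.1 q := by
  simp [pfUpdate, Function.update_of_ne (show q ≠ k + 1 by lia)]

theorem eve_update {A : ℕ → ℕ → ℕ} {a : ℕ → ℕ} {q : ℕ} (hq : q ≤ k) :
    eve (Function.update A k a) q = eve A q := by
  induction q with
  | zero => rfl
  | succ q ih =>
    funext i
    simp [eve, ih (by lia), Function.update_of_ne (show q ≠ k by lia)]

theorem pfUpdate_particle {m : ℕ} (ω : PState X) (y : Fin m → ℕ × X) (i : Fin m) :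
    (pfUpdate k m ω y).1 (k + 1) i = (y i).2 := by
  simp [pfUpdate, padF]

theorem eve_pfUpdate {m : ℕ} (ω : PState X) (y : Fin m → ℕ × X) (i : Fin m) :
    eve (pfUpdate k m ω y).2 (k + 1) i = eve ω.2 k (y i).1 := by
  simp [pfUpdate, padF, eve, eve_update le_rfl]

theorem etaN_pfUpdate_of_le {m q : ℕ} (hq : q ≤ k) (ω : PState X) (y : Fin m → ℕ × X) :
    etaN Np q f (pfUpdate k m ω y) = etaN Np q f ω := by
  simp only [etaN, pfUpdate_fst_of_le hq]

theorem normC_pfUpdate {m : ℕ} (ω : PState X) (y : Fin m → ℕ × X) :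
    normC G Np (k + 1) (pfUpdate k m ω y) = normC G Np (k + 1) ω :=
  Finset.prod_congr rfl fun _ hq =>
    etaN_pfUpdate_of_le (Nat.lt_succ_iff.1 (Finset.mem_range.1 hq)) ω y

theorem etaN_pfUpdate (ω : PState X) (y : Fin (Np (k + 1)) → ℕ × X) :
    etaN Np (k + 1) f (pfUpdate k (Np (k + 1)) ω y)
      = (Np (k + 1) : ℝ)⁻¹ * ∑ i, f (y i).2 := by
  simp only [etaN, Finset.sum_range, pfUpdate_particle]

theorem pairStat_pfUpdate (ω : PState X) (y : Fin (Np (k + 1)) → ℕ × X) :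
    pairStat r Np (k + 1) f g (pfUpdate k (Np (k + 1)) ω y)
      = (Np (k + 1) : ℝ)⁻¹ ^ 2 * ∑ i, ∑ j, pairFun r (eve ω.2 k) f g (y i, y j) := by
  simp only [pairStat, Finset.sum_range, pfUpdate_particle, eve_pfUpdate, pairFun]

theorem wStat_pfUpdate (ω : PState X) (y : Fin (Np (k + 1)) → ℕ × X) :
    wStat r G Np (k + 1) f g (pfUpdate k (Np (k + 1)) ω y)
      = normC G Np (k + 1) ω ^ 2 * (Np (k + 1) : ℝ)⁻¹ ^ 2
        * ∑ i, ∑ j, pairFun r (eve ω.2 k) f g (y i, y j) := by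
  rw [wStat, normC_pfUpdate, pairStat_pfUpdate, mul_assoc]

end Update

section Moments

variable (M : ℕ → Kernel X X) [∀ p, IsMarkovKernel (M p)] {G : ℕ → X → ℝ} {Np : ℕ → ℕ} {k : ℕ}
  {r : ℕ → ℕ → ℝ} {f g : X → ℝ}

theorem integral_oneStep_snd (hG : IsPotential (G k)) (hN : 1 ≤ Np k) (hf : BddMeas f)
    (ω : PState X) :
    ∫ q, f q.2 ∂(oneStep M G Np k (ω.1 k))
      = etaN Np k (qOp M G k f) ω / etaN Np k (G k) ω := by
  have hN' : (Np k : ℝ) ≠ 0 := by positivity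
  have hS := (sum_potential_pos (Np := Np) hG hN (ω.1 k)).ne'
  rw [integral_oneStep M hG _ (hf.comp measurable_snd)]
  simp only [etaN, qOp]
  field_simp

theorem integral_oneStep_pairFun (hG : IsPotential (G k)) (hN : 1 ≤ Np k)
    (hr : ∀ a b, |r a b| ≤ 1) (hf : BddMeas f) (hg : BddMeas g) (ω : PState X) :
    ∫ q, pairFun r (eve ω.2 k) f g q
        ∂((oneStep M G Np k (ω.1 k)).prod (oneStep M G Np k (ω.1 k)))
      = pairStat r Np k (qOp M G k f) (qOp M G k g) ω / etaN Np k (G k) ω ^ 2 := by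
  have := isProbabilityMeasure_oneStep M hG hN (ω.1 k)
  have hN' : (Np k : ℝ) ≠ 0 := by positivity
  have hS := (sum_potential_pos (Np := Np) hG hN (ω.1 k)).ne'
  have hB := bddMeas_pairFun hr (eve ω.2 k) hf hg
  rw [integral_prod _ (hB.integrable _)]
  have h1 : ∀ q : ℕ × X, ∫ q', pairFun r (eve ω.2 k) f g (q, q') ∂(oneStep M G Np k (ω.1 k))
      = (∑ j ∈ Finset.range (Np k), G k (ω.1 k j))⁻¹ * ∑ j ∈ Finset.range (Np k),
        r (eve ω.2 k q.1) (eve ω.2 k j) * qOp M G k g (ω.1 k j) * f q.2 := fun q => by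
    rw [integral_oneStep M hG _ (hB.comp measurable_prodMk_left)]
    congr 1
    refine Finset.sum_congr rfl fun j _ => ?_
    simp only [pairFun, integral_const_mul, qOp]
    ring
  simp only [h1]
  have h2 : ∀ j, BddMeas fun q : ℕ × X =>
      r (eve ω.2 k q.1) (eve ω.2 k j) * qOp M G k g (ω.1 k j) * f q.2 := fun j =>
    ((bddMeas_coupling hr (Measurable.of_discrete.comp measurable_fst) measurable_const).mul
      (.const _)).mul (hf.comp measurable_snd)
  rw [integral_const_mul, integral_finsetSum _ fun j _ => (h2 j).integrable _]
  simp only [integral_oneStep M hG _ (h2 _), integral_const_mul]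
  rw [← Finset.mul_sum, Finset.sum_comm, pairStat, etaN]
  have h3 : ∀ i j, G k (ω.1 k i) * (r (eve ω.2 k i) (eve ω.2 k j) * qOp M G k g (ω.1 k j)
      * ∫ x, f x ∂(M (k + 1) (ω.1 k i))) = r (eve ω.2 k i) (eve ω.2 k j)
        * (qOp M G k f (ω.1 k i) * qOp M G k g (ω.1 k j)) := fun i j => by
    simp only [qOp]; ring
  simp only [h3]
  field_simp

variable [Nonempty X]

theorem integral_gammaN_step (hG : IsPotential (G k)) (hN : 1 ≤ Np k) (hN1 : 1 ≤ Np (k + 1))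
    (hf : BddMeas f) (ω : PState X) :
    ∫ y, gammaN G Np (k + 1) f (pfUpdate k (Np (k + 1)) ω y)
        ∂(Measure.pi fun _ => oneStep M G Np k (ω.1 k))
      = gammaN G Np k (qOp M G k f) ω := by
  have := isProbabilityMeasure_oneStep M hG hN (ω.1 k)
  have hN' : (Np (k + 1) : ℝ) ≠ 0 := by positivity
  have hη := (etaN_pos (Np := Np) hG hN ω).ne'
  simp only [gammaN_eq, normC_pfUpdate, etaN_pfUpdate]
  rw [integral_const_mul, integral_const_mul, integral_pi_sum _ (hf.comp measurable_snd),
    integral_oneStep_snd M hG hN hf, normC_succ, gammaN_eq]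
  field_simp

theorem integral_wStat_step (hG : IsPotential (G k)) (hN : 1 ≤ Np k) (hN1 : 1 ≤ Np (k + 1))
    (hr : ∀ a b, |r a b| ≤ 1) {d : ℝ} (hd : ∀ a, r a a = d) (hf : BddMeas f) (hg : BddMeas g)
    (ω : PState X) :
    ∫ y, wStat r G Np (k + 1) f g (pfUpdate k (Np (k + 1)) ω y)
        ∂(Measure.pi fun _ => oneStep M G Np k (ω.1 k))
      = (Np (k + 1) : ℝ)⁻¹ * d * (gammaN G Np k (G k) ω
          * gammaN G Np k (qOp M G k fun x => f x * g x) ω)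
        + (1 - (Np (k + 1) : ℝ)⁻¹) * wStat r G Np k (qOp M G k f) (qOp M G k g) ω := by
  have := isProbabilityMeasure_oneStep M hG hN (ω.1 k)
  have hN' : (Np (k + 1) : ℝ) ≠ 0 := by positivity
  have hη := (etaN_pos (Np := Np) hG hN ω).ne'
  simp only [wStat_pfUpdate]
  rw [integral_const_mul, integral_pi_sum_pairs _ (bddMeas_pairFun hr _ hf hg),
    integral_oneStep_pairFun M hG hN hr hf hg]
  have hdiag : ∫ q, pairFun r (eve ω.2 k) f g (q, q) ∂(oneStep M G Np k (ω.1 k))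
      = d * (etaN Np k (qOp M G k fun x => f x * g x) ω / etaN Np k (G k) ω) := by
    simp only [pairFun, hd, integral_const_mul]
    rw [integral_oneStep_snd M hG hN (hf.mul hg)]
  rw [hdiag, normC_succ]
  simp only [gammaN_eq, wStat]
  field_simp

/-- The indicator of equality of Eve indices. -/
def rEq (a b : ℕ) : ℝ := if a = b then 1 else 0

theorem abs_rEq_le (a b : ℕ) : |rEq a b| ≤ 1 := by
  unfold rEq; split_ifs <;> simp

theorem integral_sq_dev_wStat_step (hG : ∀ q < k + 1, IsPotential (G q)) (hN : 1 ≤ Np k)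
    (hf : BddMeas f) (hg : BddMeas g) {C K δ : ℝ} (hC : 0 ≤ C)
    (hfg : ∀ x x', |f x * g x'| ≤ C) (hδ : 0 < δ) (ω : PState X)
    (hK : normC G Np (k + 1) ω ^ 2 ≤ K) :
    ∫ y, (wStat rEq G Np (k + 1) f g (pfUpdate k (Np (k + 1)) ω y)
        - ∫ y', wStat rEq G Np (k + 1) f g (pfUpdate k (Np (k + 1)) ω y')
          ∂(Measure.pi fun _ => oneStep M G Np k (ω.1 k))) ^ 2
        ∂(Measure.pi fun _ => oneStep M G Np k (ω.1 k))
      ≤ 4 * C ^ 2 * (δ * ∫ y, wStat rEq G Np (k + 1) 1 1 (pfUpdate k (Np (k + 1)) ω y) ^ 2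
          ∂(Measure.pi fun _ => oneStep M G Np k (ω.1 k))
        + δ⁻¹ * (K * (Np (k + 1) : ℝ)⁻¹ ^ 2)
          * ∫ y, wStat rEq G Np (k + 1) 1 1 (pfUpdate k (Np (k + 1)) ω y)
          ∂(Measure.pi fun _ => oneStep M G Np k (ω.1 k))) := by
  have := isProbabilityMeasure_oneStep M (hG k k.lt_succ_self) hN (ω.1 k)
  have hone : BddMeas (1 : X → ℝ) := .const 1
  have hB : ∀ {f g : X → ℝ}, BddMeas f → BddMeas g → ∀ i j : Fin (Np (k + 1)),
      BddMeas fun y : Fin (Np (k + 1)) → ℕ × X => pairFun rEq (eve ω.2 k) f g (y i, y j) :=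
    fun hf hg i j => (bddMeas_pairFun abs_rEq_le _ hf hg).comp
      ((measurable_pi_apply i).prodMk (measurable_pi_apply j))
  set s := normC G Np (k + 1) ω ^ 2 * (Np (k + 1) : ℝ)⁻¹ ^ 2 with hs
  have hs0 : 0 ≤ s := by positivity
  have hsK : s ≤ K * (Np (k + 1) : ℝ)⁻¹ ^ 2 := by rw [hs]; gcongr
  have h0 : ∀ (i j : Fin (Np (k + 1))) (y : Fin (Np (k + 1)) → ℕ × X), 0 ≤ pairFun rEq (eve ω.2 k) 1 1 (y i, y j) := by
    intro i j y
    simp only [pairFun, rEq]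
    split_ifs <;> simp
  have hvar := integral_sq_dev_double_sum_le
    (Measure.pi fun _ : Fin (Np (k + 1)) => oneStep M G Np k (ω.1 k))
    (hB hf hg) (hB hone hone) hC
    (by
      intro i j y
      simp only [pairFun, rEq, abs_mul]
      split_ifs
      · simpa [abs_mul] using hfg _ _
      · simp)
    h0
    (by intro i j; funext y; simp only [pairFun, rEq, eq_comm]; rfl)
    (by
      intro i j l y
      simp only [pairFun, rEq]
      by_cases h1 : eve ω.2 k (y i).1 = eve ω.2 k (y j).1
      · by_cases h2 : eve ω.2 k (y i).1 = eve ω.2 k (y l).1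
        · simp [h1.symm.trans h2, h1]
        · rw [if_neg h2]; split_ifs <;> simp
      · rw [if_neg h1]; split_ifs <;> simp)
    (fun i j k' l h1 h2 h3 h4 => integral_pi_mul_pairs _ h1 h2 h3 h4
      (bddMeas_pairFun abs_rEq_le _ hf hg)) hδ
  simp only [wStat_pfUpdate]
  simp only [← hs, integral_const_mul, ← mul_sub, mul_pow]
  have hI : 0 ≤ ∫ y, ∑ i, ∑ j, pairFun rEq (eve ω.2 k) 1 1 (y i, y j)
      ∂(Measure.pi fun _ : Fin (Np (k + 1)) => oneStep M G Np k (ω.1 k)) :=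
    integral_nonneg fun y => Finset.sum_nonneg fun i _ => Finset.sum_nonneg fun j _ => h0 i j y
  refine (mul_le_mul_of_nonneg_left hvar (sq_nonneg s)).trans ?_
  have h5 := mul_le_mul_of_nonneg_right hsK (mul_nonneg hs0 hI)
  have h6 := mul_le_mul_of_nonneg_left h5
    (mul_nonneg (by positivity : 0 ≤ 4 * C ^ 2) (inv_nonneg.2 hδ.le))
  nlinarith [h6]

end Moments

/-! ### The limiting Feynman–Kac quantities -/

theorem BddMeas.one {α : Type*} [MeasurableSpace α] : BddMeas (1 : α → ℝ) := .const 1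

theorem measurable_diag : Measurable fun x : X => (x, x) := measurable_id.prodMk measurable_id

section FeynmanKac

variable (M0 : Measure X) [IsProbabilityMeasure M0] (M : ℕ → Kernel X X)
  [∀ p, IsMarkovKernel (M p)] {G : ℕ → X → ℝ} {k : ℕ} {f g : X → ℝ}

theorem isFiniteMeasure_gammaFK (hG : ∀ p < k, IsPotential (G p)) :
    IsFiniteMeasure (gammaFK M0 M G k) := by
  induction k with
  | zero => exact inferInstanceAs (IsFiniteMeasure M0)
  | succ k ih =>
    have := ih fun p hp => hG p (hp.trans k.lt_succ_self)
    have hd : IsFiniteMeasure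
        ((gammaFK M0 M G k).withDensity fun x => ENNReal.ofReal (G k x)) :=
      isFiniteMeasure_withDensity_ofReal
        ((hG k k.lt_succ_self).toBddMeas.integrable (gammaFK M0 M G k)).2
    rw [gammaFK]
    infer_instance

theorem gInt_succ (hG : ∀ p < k + 1, IsPotential (G p)) (hf : BddMeas f) :
    gInt M0 M G (k + 1) f = gInt M0 M G k (qOp M G k f) := by
  have hk := hG k k.lt_succ_self
  have := isFiniteMeasure_gammaFK M0 M fun p hp => hG p (hp.trans k.lt_succ_self)
  have hd : IsFiniteMeasure
      ((gammaFK M0 M G k).withDensity fun x => ENNReal.ofReal (G k x)) :=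
    isFiniteMeasure_withDensity_ofReal (hk.toBddMeas.integrable (gammaFK M0 M G k)).2
  set ν := (gammaFK M0 M G k).withDensity fun x => ENNReal.ofReal (G k x) with hν
  have hbind : gammaFK M0 M G (k + 1) = (ν ⊗ₘ M (k + 1)).map Prod.snd :=
    (Measure.snd_compProd ν (M (k + 1))).symm
  rw [gInt, hbind, integral_map measurable_snd.aemeasurable
      hf.measurable.aestronglyMeasurable,
    Measure.integral_compProd ((hf.comp measurable_snd).integrable _), hν,
    integral_withDensity_eq_integral_toReal_smul hk.measurable.ennreal_ofReal
      (ae_of_all _ fun _ => ENNReal.ofReal_lt_top)]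
  simp only [ENNReal.toReal_ofReal (hk.pos _).le]
  rfl

theorem isPotential_qOp (hG : IsPotential (G k)) (hg : IsPotential g) :
    IsPotential (qOp M G k g) where
  toBddMeas := .qOp M hG.toBddMeas hg.toBddMeas
  pos x := mul_pos (hG.pos x) <| by
    rw [integral_pos_iff_support_of_nonneg (fun y => (hg.pos y).le) (hg.toBddMeas.integrable _),
      Function.support_eq_univ (fun y => (hg.pos y).ne')]
    simp

theorem gInt_pos (hG : ∀ p < k, IsPotential (G p)) (hg : IsPotential g) :
    0 < gInt M0 M G k g := by
  induction k generalizing g with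
  | zero =>
    rw [gInt, gammaFK,
      integral_pos_iff_support_of_nonneg (fun y => (hg.pos y).le) (hg.toBddMeas.integrable _),
      Function.support_eq_univ (fun y => (hg.pos y).ne')]
    simp
  | succ k ih =>
    rw [gInt_succ M0 M hG hg.toBddMeas]
    exact ih (fun p hp => hG p (hp.trans k.lt_succ_self))
      (isPotential_qOp M (hG k k.lt_succ_self) hg)

/-- The doubled-chain transitions as a kernel. -/
def pairKernel (b : ℕ → Bool) (p : ℕ) : Kernel (X × X) (X × X) :=
  if b p then ((M p).comap Prod.fst measurable_fst).map fun y => (y, y)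
  else (M p).comap Prod.fst measurable_fst ×ₖ (M p).comap Prod.snd measurable_snd

instance (b : ℕ → Bool) (p : ℕ) : IsMarkovKernel (pairKernel M b p) := by
  unfold pairKernel
  split_ifs
  · exact Kernel.IsMarkovKernel.map _ (measurable_diag)
  · infer_instance

theorem pairKernel_apply (b : ℕ → Bool) (p : ℕ) (q : X × X) :
    pairKernel M b p q = pairKer M b p q := by
  unfold pairKernel pairKer
  split_ifs
  · rw [Kernel.map_apply _ (measurable_diag), Kernel.comap_apply]
  · rw [Kernel.prod_apply, Kernel.comap_apply, Kernel.comap_apply]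

theorem markovPath_succ (b : ℕ → Bool) (μ0 : Measure (X × X)) (k : ℕ) :
    markovPath μ0 (pairKer M b) (k + 1) = (markovPath μ0 (pairKer M b) k).bind fun ω =>
      ((pairKernel M b (k + 1)).comap (fun ω : ℕ → X × X => ω k) (measurable_pi_apply k) ω).map
        fun y => Function.update ω (k + 1) y := by
  simp only [markovPath, Kernel.comap_apply, pairKernel_apply]

theorem isProbabilityMeasure_markovPath (b : ℕ → Bool) (μ0 : Measure (X × X))
    [IsProbabilityMeasure μ0] (k : ℕ) :
    IsProbabilityMeasure (markovPath μ0 (pairKer M b) k) := by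
  induction k with
  | zero =>
    have h : Measurable fun (y : X × X) (_ : ℕ) => y := measurable_pi_iff.2 fun _ => measurable_id
    exact Measure.isProbabilityMeasure_map h.aemeasurable
  | succ k ih =>
    rw [markovPath_succ M]
    exact isProbabilityMeasure_bind_map (A := ℕ → X × X) (B := X × X) _ _ measurable_update'

instance (b : ℕ → Bool) : IsProbabilityMeasure (pairInit M0 b) := by
  unfold pairInit
  split_ifs
  · exact Measure.isProbabilityMeasure_map (measurable_diag).aemeasurable
  · infer_instance

theorem bddMeas_pathWeight (hG : ∀ p < k, IsPotential (G p)) {F : X × X → ℝ} (hF : BddMeas F) :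
    BddMeas fun ω : ℕ → X × X => F (ω k) * ∏ p ∈ Finset.range k, G p (ω p).1 * G p (ω p).2 :=
  (hF.comp (measurable_pi_apply k)).mul <| BddMeas.prod _ fun p hp =>
    have hp' := (hG p (Finset.mem_range.1 hp)).toBddMeas
    (hp'.comp (measurable_fst.comp (measurable_pi_apply p))).mul
      (hp'.comp (measurable_snd.comp (measurable_pi_apply p)))

theorem muB_zero (b : ℕ → Bool) {F : X × X → ℝ} (hF : BddMeas F) :
    muB M0 M G 0 b F = ∫ q, F q ∂(pairInit M0 b) := by
  simp only [muB, Finset.range_zero, Finset.prod_empty, mul_one, markovPath]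
  rw [integral_map (measurable_pi_iff.2 fun _ => measurable_id').aemeasurable
    (hF.comp (measurable_pi_apply 0)).measurable.aestronglyMeasurable]

theorem muB_succ (hG : ∀ p < k + 1, IsPotential (G p)) (b : ℕ → Bool) {F : X × X → ℝ}
    (hF : BddMeas F) :
    muB M0 M G (k + 1) b F
      = muB M0 M G k b fun q => G k q.1 * G k q.2 * ∫ q', F q' ∂(pairKer M b (k + 1) q) := by
  have := isProbabilityMeasure_markovPath M b (pairInit M0 b) k
  rw [muB, markovPath_succ, integral_bind_map (A := ℕ → X × X) (B := X × X) _ _ measurable_update' (bddMeas_pathWeight hG hF)]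
  refine integral_congr_ae (ae_of_all _ fun ω => ?_)
  have h : ∀ y, ∏ p ∈ Finset.range (k + 1), G p (Function.update ω (k + 1) y p).1
        * G p (Function.update ω (k + 1) y p).2
      = ∏ p ∈ Finset.range (k + 1), G p (ω p).1 * G p (ω p).2 := fun y =>
    Finset.prod_congr rfl fun p hp => by
      rw [Function.update_of_ne (Finset.mem_range.1 hp).ne]
  simp only [h, Function.update_self, integral_mul_const, Kernel.comap_apply, pairKernel_apply]
  rw [Finset.prod_range_succ]
  ring

/-- `(f ⊗ g)(x, x') = f(x) g(x')`. -/
def tensor (f g : X → ℝ) : X × X → ℝ := fun q => f q.1 * g q.2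

theorem bddMeas_tensor (hf : BddMeas f) (hg : BddMeas g) : BddMeas (tensor f g) :=
  (hf.comp measurable_fst).mul (hg.comp measurable_snd)

theorem muB_succ_of_false (hG : ∀ p < k + 1, IsPotential (G p)) {b : ℕ → Bool}
    (hb : b (k + 1) = false) (hf : BddMeas f) (hg : BddMeas g) :
    muB M0 M G (k + 1) b (tensor f g)
      = muB M0 M G k b (tensor (qOp M G k f) (qOp M G k g)) := by
  rw [muB_succ M0 M hG b (bddMeas_tensor hf hg)]
  congr 1
  funext q
  simp only [pairKer, hb, tensor, qOp]
  rw [if_neg Bool.false_ne_true, integral_prod_mul]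
  ring

theorem muB_succ_of_true (hG : ∀ p < k + 1, IsPotential (G p)) {b : ℕ → Bool}
    (hb : b (k + 1) = true) (hf : BddMeas f) (hg : BddMeas g) :
    muB M0 M G (k + 1) b (tensor f g)
      = muB M0 M G k b (tensor (qOp M G k fun x => f x * g x) (G k)) := by
  rw [muB_succ M0 M hG b (bddMeas_tensor hf hg)]
  congr 1
  funext q
  simp only [pairKer, hb, if_pos]
  rw [integral_map (measurable_diag).aemeasurable
    (bddMeas_tensor hf hg).measurable.aestronglyMeasurable]
  simp only [tensor, qOp]
  ring

theorem muB_of_false (hG : ∀ p < k, IsPotential (G p)) {b : ℕ → Bool}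
    (hb : ∀ p ≤ k, b p = false) (hf : BddMeas f) (hg : BddMeas g) :
    muB M0 M G k b (tensor f g) = gInt M0 M G k f * gInt M0 M G k g := by
  induction k generalizing f g with
  | zero =>
    rw [muB_zero M0 M b (bddMeas_tensor hf hg), pairInit, hb 0 le_rfl, if_neg Bool.false_ne_true]
    exact integral_prod_mul f g
  | succ k ih =>
    have hk := (hG k k.lt_succ_self).toBddMeas
    rw [muB_succ_of_false M0 M hG (hb _ le_rfl) hf hg, gInt_succ M0 M hG hf, gInt_succ M0 M hG hg]
    exact ih (fun p hp => hG p (hp.trans k.lt_succ_self)) (fun p hp => hb p (by lia))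
      (.qOp M hk hf) (.qOp M hk hg)

/-- The limit of the coalescence statistics, `∑_{p ≤ k} c_p⁻¹ μ_{e_p}(f ⊗ g)`. -/
def coalLim (G : ℕ → X → ℝ) (c : ℕ → ℝ) (k : ℕ) (f g : X → ℝ) : ℝ :=
  ∑ p ∈ Finset.range (k + 1), (c p)⁻¹ * muB M0 M G k (eVec p) (tensor f g)

theorem coalLim_zero (c : ℕ → ℝ) (hf : BddMeas f) (hg : BddMeas g) :
    coalLim M0 M G c 0 f g = (c 0)⁻¹ * gInt M0 M G 0 fun x => f x * g x := by
  have hT := bddMeas_tensor hf hg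
  rw [coalLim, Finset.sum_range_one, muB_zero M0 M _ hT, pairInit,
    show eVec 0 0 = true from rfl, if_pos rfl,
    integral_map (measurable_diag).aemeasurable
      hT.measurable.aestronglyMeasurable]
  rfl

theorem qOp_one (x : X) : qOp M G k 1 x = G k x := by
  simp [qOp]

theorem coalLim_succ (c : ℕ → ℝ) (hG : ∀ p < k + 1, IsPotential (G p)) (hf : BddMeas f)
    (hg : BddMeas g) :
    coalLim M0 M G c (k + 1) f g
      = (c (k + 1))⁻¹ * (gInt M0 M G k (G k) * gInt M0 M G k (qOp M G k fun x => f x * g x))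
        + coalLim M0 M G c k (qOp M G k f) (qOp M G k g) := by
  have hk := (hG k k.lt_succ_self).toBddMeas
  rw [coalLim, Finset.sum_range_succ, add_comm, coalLim,
    muB_succ_of_true M0 M hG (by simp [eVec]) hf hg,
    muB_of_false M0 M (fun p hp => hG p (hp.trans k.lt_succ_self))
      (fun p hp => by simp [eVec]; lia) (.qOp M hk (hf.mul hg)) hk,
    mul_comm (gInt M0 M G k (qOp M G k _))]
  congr 1
  refine Finset.sum_congr rfl fun p hp => ?_
  have hp' := Finset.mem_range.1 hp
  rw [muB_succ_of_false M0 M hG (by simp [eVec]; lia) hf hg]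

theorem sigma2Hat_eq (c : ℕ → ℝ) (hG : ∀ p < k + 1, IsPotential (G p)) (hf : BddMeas f) :
    sigma2Hat M0 M G c k f = (coalLim M0 M G c k (hatf G k f) (hatf G k f)
      - (∑ p ∈ Finset.range (k + 1), (c p)⁻¹) * gInt M0 M G k (hatf G k f) ^ 2)
        / gInt M0 M G k (G k) ^ 2 := by
  have hk := hG k k.lt_succ_self
  have hG' : ∀ p < k, IsPotential (G p) := fun p hp => hG p (hp.trans k.lt_succ_self)
  have h1 : gInt M0 M G k 1 ≠ 0 :=
    (gInt_pos M0 M hG' ⟨BddMeas.one, fun _ => one_pos⟩).ne'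
  have h2 : gInt M0 M G k (G k) ≠ 0 := (gInt_pos M0 M hG' hk).ne'
  have hF : BddMeas (hatf G k f) := hk.toBddMeas.mul hf
  rw [sigma2Hat, coalLim, Finset.sum_mul, ← Finset.sum_sub_distrib, Finset.sum_div]
  refine Finset.sum_congr rfl fun p _ => ?_
  have h3 : tens (hatf G k f) = tensor (hatf G k f) (hatf G k f) := rfl
  rw [vpnHat, vpn, eInt, h3, muB_of_false M0 M hG' (b := zeroVec) (fun _ _ => rfl) hF hF]
  field_simp

end FeynmanKac

/-! ### Unbiasedness -/

/-- The indicator of inequality of Eve indices. -/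
def rNe (a b : ℕ) : ℝ := if a ≠ b then 1 else 0

theorem abs_rNe_le (a b : ℕ) : |rNe a b| ≤ 1 := by
  unfold rNe; split_ifs <;> simp

section Algebra

variable {G : ℕ → X → ℝ} {Np : ℕ → ℕ} {k : ℕ} {r : ℕ → ℕ → ℝ} {f g : X → ℝ}

theorem etaN_mul_etaN (f g : X → ℝ) (ω : PState X) :
    etaN Np k f ω * etaN Np k g ω = pairStat (fun _ _ => 1) Np k f g ω := by
  simp only [etaN, pairStat, one_mul, ← Finset.mul_sum, ← Finset.sum_mul]
  ring

theorem wStat_one (f g : X → ℝ) (ω : PState X) :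
    wStat (fun _ _ => 1) G Np k f g ω = gammaN G Np k f ω * gammaN G Np k g ω := by
  rw [wStat, ← etaN_mul_etaN, gammaN_eq, gammaN_eq]
  ring

theorem wStat_rNe (f g : X → ℝ) (ω : PState X) :
    wStat rNe G Np k f g ω
      = gammaN G Np k f ω * gammaN G Np k g ω - wStat rEq G Np k f g ω := by
  rw [← wStat_one, wStat, wStat, wStat, ← mul_sub, pairStat, pairStat, pairStat, ← mul_sub]
  simp only [← Finset.sum_sub_distrib, ← sub_mul]
  congr 2
  refine Finset.sum_congr rfl fun i _ => Finset.sum_congr rfl fun j _ => ?_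
  congr 1
  unfold rNe rEq
  split_ifs <;> simp_all

theorem pairStat_zero {d e : ℝ} (hd : ∀ a, r a a = d) (he : ∀ a b, a ≠ b → r a b = e)
    (f g : X → ℝ) (ω : PState X) :
    pairStat r Np 0 f g ω = e * (etaN Np 0 f ω * etaN Np 0 g ω)
      + (d - e) * (Np 0 : ℝ)⁻¹ * etaN Np 0 (fun x => f x * g x) ω := by
  have h : ∀ i j, r i j = e + (d - e) * if i = j then 1 else 0 := fun i j => by
    split_ifs with hij
    · rw [hij, hd]; ring
    · rw [he _ _ hij]; ring
  simp only [etaN_mul_etaN, pairStat, eve, h, add_mul, Finset.sum_add_distrib, mul_assoc,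
    ← Finset.mul_sum, ite_mul, zero_mul, one_mul, Finset.sum_ite_eq, Finset.mem_range]
  rw [etaN, mul_add, Finset.sum_congr rfl fun i hi => if_pos (Finset.mem_range.1 hi)]
  ring

theorem normC_sq_mul_Vest (hN : 2 ≤ Np k) (f : X → ℝ) (ω : PState X) :
    normC G Np k ω ^ 2 * Vest Np k f ω = gammaN G Np k f ω ^ 2
      - (∏ p ∈ Finset.range (k + 1), (Np p : ℝ) / ((Np p : ℝ) - 1))
        * wStat rNe G Np k f f ω := by
  have h2 : (2 : ℝ) ≤ Np k := by exact_mod_cast hN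
  have h0 : (Np k : ℝ) ≠ 0 := by linarith
  have h1 : (Np k : ℝ) - 1 ≠ 0 := by linarith
  have hS : ∀ i j, (if eve ω.2 k i ≠ eve ω.2 k j then f (ω.1 k i) * f (ω.1 k j) else 0)
      = rNe (eve ω.2 k i) (eve ω.2 k j) * (f (ω.1 k i) * f (ω.1 k j)) := fun i j => by
    unfold rNe; split_ifs <;> simp
  simp only [Vest, hS, wStat, pairStat, gammaN_eq]
  rw [Finset.prod_range_succ]
  field_simp

theorem gammaHatN_one_sq_mul_VestHat (hG : IsPotential (G k)) (hN : 2 ≤ Np k) (f : X → ℝ)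
    (ω : PState X) :
    gammaHatN G Np k 1 ω ^ 2 * VestHat G Np k f ω
      = normC G Np k ω ^ 2 * Vest Np k (hatf G k f) ω := by
  have hη := (etaN_pos (Np := Np) (p := k) hG (by lia) ω).ne'
  have h1 : hatf G k 1 = G k := by funext x; simp [hatf]
  rw [gammaHatN, h1, gammaN_eq, VestHat]
  field_simp

end Algebra

section Unbiased

variable (M0 : Measure X) [IsProbabilityMeasure M0] (M : ℕ → Kernel X X)
  [∀ p, IsMarkovKernel (M p)] {G : ℕ → X → ℝ} {Np : ℕ → ℕ} {k : ℕ} {f g : X → ℝ} [Nonempty X]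

theorem etaN_pfInit (h : X → ℝ) (y : Fin (Np 0) → X) :
    etaN Np 0 h ((fun p => if p = 0 then padF y else fun _ => Classical.arbitrary X,
      fun _ _ => 0) : PState X) = (Np 0 : ℝ)⁻¹ * ∑ i, h (y i) := by
  simp [etaN, Finset.sum_range, padF]

theorem integral_etaN_zero (hN : 1 ≤ Np 0) (hf : BddMeas f) :
    ∫ ω, etaN Np 0 f ω ∂(pfLaw M0 M G Np 0) = ∫ x, f x ∂M0 := by
  have hN' : (Np 0 : ℝ) ≠ 0 := by positivity
  rw [integral_pfLaw_zero M0 M (bddMeas_etaN hf)]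
  simp only [etaN_pfInit]
  rw [integral_const_mul, integral_pi_sum _ hf]
  field_simp

theorem integral_etaN_mul_zero (hN : 1 ≤ Np 0) (hf : BddMeas f) (hg : BddMeas g) :
    ∫ ω, etaN Np 0 f ω * etaN Np 0 g ω ∂(pfLaw M0 M G Np 0)
      = (Np 0 : ℝ)⁻¹ * (∫ x, f x * g x ∂M0)
        + (1 - (Np 0 : ℝ)⁻¹) * ((∫ x, f x ∂M0) * ∫ x, g x ∂M0) := by
  have hN' : (Np 0 : ℝ) ≠ 0 := by positivity
  have hB : BddMeas fun q : X × X => f q.1 * g q.2 := bddMeas_tensor hf hg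
  have hsum : ∀ y : Fin (Np 0) → X, (Np 0 : ℝ)⁻¹ * (∑ i, f (y i)) * ((Np 0 : ℝ)⁻¹ * ∑ i, g (y i))
      = (Np 0 : ℝ)⁻¹ ^ 2 * ∑ i, ∑ j, f (y i) * g (y j) := fun y => by
    simp only [← Finset.mul_sum, ← Finset.sum_mul]
    ring
  rw [integral_pfLaw_zero M0 M ((bddMeas_etaN hf).mul (bddMeas_etaN hg))]
  simp only [etaN_pfInit, hsum]
  rw [integral_const_mul, integral_pi_sum_pairs M0 hB, integral_prod_mul]
  field_simp

theorem integral_gammaN (hG : ∀ p < k, IsPotential (G p)) (hN : ∀ p ≤ k, 1 ≤ Np p)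
    (hf : BddMeas f) :
    ∫ ω, gammaN G Np k f ω ∂(pfLaw M0 M G Np k) = gInt M0 M G k f := by
  induction k generalizing f with
  | zero => simpa [gammaN, gInt, gammaFK] using integral_etaN_zero M0 M (hN 0 le_rfl) hf
  | succ k ih =>
    have hk := k.lt_succ_self
    rw [integral_pfLaw_succ M0 M hG (fun p hp => hN p hp.le) (bddMeas_gammaN hG hf)]
    simp only [integral_gammaN_step M (hG k hk) (hN k hk.le) (hN _ le_rfl) hf]
    rw [ih (fun p hp => hG p (hp.trans hk)) (fun p hp => hN p (hp.trans hk.le))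
      (.qOp M (hG k hk).toBddMeas hf), gInt_succ M0 M hG hf]

theorem integral_wStat_rNe (hG : ∀ p < k, IsPotential (G p)) (hN : ∀ p ≤ k, 1 ≤ Np p)
    (hf : BddMeas f) (hg : BddMeas g) :
    ∫ ω, wStat rNe G Np k f g ω ∂(pfLaw M0 M G Np k)
      = (∏ p ∈ Finset.range (k + 1), (1 - (Np p : ℝ)⁻¹))
        * (gInt M0 M G k f * gInt M0 M G k g) := by
  have hd : ∀ a, rNe a a = 0 := fun a => by simp [rNe]
  induction k generalizing f g with
  | zero =>
    have := isProbabilityMeasure_pfLaw M0 M (G := G) (Np := Np) (k := 0) (by simp) (by simp)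
    have he : ∀ a b, a ≠ b → rNe a b = 1 := fun a b h => by simp [rNe, h]
    simp only [wStat, normC, Finset.range_zero, Finset.prod_empty, one_pow, one_mul,
      pairStat_zero hd he]
    rw [integral_add (((bddMeas_etaN hf).mul (bddMeas_etaN hg)).integrable _)
      (((bddMeas_etaN (hf.mul hg)).const_mul _).integrable _), integral_const_mul,
      integral_etaN_mul_zero M0 M (hN 0 le_rfl) hf hg,
      integral_etaN_zero M0 M (hN 0 le_rfl) (hf.mul hg), Finset.prod_range_one]
    simp only [gInt, gammaFK]
    ring
  | succ k ih =>
    have hk := k.lt_succ_self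
    rw [integral_pfLaw_succ M0 M hG (fun p hp => hN p hp.le) (bddMeas_wStat abs_rNe_le hG hf hg)]
    simp only [integral_wStat_step M (hG k hk) (hN k hk.le) (hN _ le_rfl) abs_rNe_le hd hf hg,
      mul_zero, zero_mul, zero_add]
    have hk' := (hG k hk).toBddMeas
    rw [integral_const_mul, ih (fun p hp => hG p (hp.trans hk))
      (fun p hp => hN p (hp.trans hk.le)) (.qOp M hk' hf) (.qOp M hk' hg),
      gInt_succ M0 M hG hf, gInt_succ M0 M hG hg, Finset.prod_range_succ _ (k + 1)]
    ring

theorem integral_VestHat (hG : ∀ p ≤ k, IsPotential (G p)) (hN : ∀ p ≤ k, 2 ≤ Np p)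
    (hf : BddMeas f) :
    ∫ ω, gammaHatN G Np k (1 : X → ℝ) ω ^ 2 * VestHat G Np k f ω ∂(pfLaw M0 M G Np k)
      = variance (fun ω => gammaHatN G Np k f ω) (pfLaw M0 M G Np k) := by
  have hG' : ∀ p < k, IsPotential (G p) := fun p hp => hG p hp.le
  have hN' : ∀ p ≤ k, 1 ≤ Np p := fun p hp => one_le_two.trans (hN p hp)
  have hF : BddMeas (hatf G k f) := (hG k le_rfl).toBddMeas.mul hf
  have := isProbabilityMeasure_pfLaw M0 M hG' fun p hp => hN' p hp.le
  have hγ := bddMeas_gammaN (Np := Np) hG' hF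
  have hprod : (∏ p ∈ Finset.range (k + 1), (Np p : ℝ) / ((Np p : ℝ) - 1))
      * ∏ p ∈ Finset.range (k + 1), (1 - (Np p : ℝ)⁻¹) = 1 := by
    rw [← Finset.prod_mul_distrib]
    refine Finset.prod_eq_one fun p hp => ?_
    have h2 : (2 : ℝ) ≤ Np p := by exact_mod_cast hN p (Nat.lt_succ_iff.1 (Finset.mem_range.1 hp))
    have h0 : (Np p : ℝ) ≠ 0 := by linarith
    have h1 : (Np p : ℝ) - 1 ≠ 0 := by linarith
    field_simp
  simp only [gammaHatN_one_sq_mul_VestHat (hG k le_rfl) (hN k le_rfl),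
    normC_sq_mul_Vest (hN k le_rfl)]
  rw [integral_sub ((hγ.pow 2).integrable _)
    (((bddMeas_wStat abs_rNe_le hG' hF hF).const_mul _).integrable _), integral_const_mul,
    integral_wStat_rNe M0 M hG' hN' hF hF, ← mul_assoc, hprod, one_mul,
    variance_eq_integral (show AEMeasurable (fun ω => gammaHatN G Np k f ω) _ from
      hγ.measurable.aemeasurable)]
  simp only [gammaHatN]
  rw [integral_sq_dev _ hγ, integral_gammaN M0 M hG' hN' hF]
  ring

end Unbiased

/-! ### Convergence in probability to a constant -/

section TendstoProb

variable {Ω : Type*} [MeasurableSpace Ω]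

/-- Convergence in probability of `Z N`, under the varying laws `P N`, to the constant `l`. -/
def TendstoProb (P : ℕ → Measure Ω) (Z : ℕ → Ω → ℝ) (l : ℝ) : Prop :=
  ∀ ε : ℝ, 0 < ε → Tendsto (fun N => P N {ω | ε ≤ |Z N ω - l|}) atTop (nhds 0)

variable {P : ℕ → Measure Ω} {Y Z : ℕ → Ω → ℝ} {a b : ℝ}

theorem TendstoProb.map₂ (hY : TendstoProb P Y a) (hZ : TendstoProb P Z b) {h : ℝ → ℝ → ℝ}
    (hh : ContinuousAt (Function.uncurry h) (a, b)) :
    TendstoProb P (fun N ω => h (Y N ω) (Z N ω)) (h a b) := by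
  intro ε hε
  obtain ⟨δ, hδ, hδε⟩ := Metric.continuousAt_iff.1 hh ε hε
  have hsum := (hY δ hδ).add (hZ δ hδ)
  rw [add_zero] at hsum
  refine tendsto_of_tendsto_of_tendsto_of_le_of_le tendsto_const_nhds hsum
    (fun _ => zero_le) fun N => (measure_mono ?_).trans (measure_union_le _ _)
  intro ω hω
  by_contra hcon
  simp only [Set.mem_union, Set.mem_ofPred_eq, not_or, not_le] at hcon
  have hd : dist (Y N ω, Z N ω) (a, b) < δ := by
    rw [Prod.dist_eq, max_lt_iff, Real.dist_eq, Real.dist_eq]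
    exact hcon
  have := hδε hd
  rw [Real.dist_eq] at this
  exact absurd hω (not_le.2 this)

theorem tendstoProb_of_tendsto {u : ℕ → ℝ} (hu : Tendsto u atTop (nhds a)) :
    TendstoProb P (fun N _ => u N) a := by
  intro ε hε
  refine tendsto_const_nhds.congr' ?_
  filter_upwards [Metric.tendsto_nhds.1 hu ε hε] with N hN
  rw [Real.dist_eq] at hN
  simp [not_le.2 hN]

theorem TendstoProb.congr (hY : TendstoProb P Y a) (h : ∀ᶠ N in atTop, ∀ ω, Y N ω = Z N ω) :
    TendstoProb P Z a := by
  intro ε hε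
  refine (hY ε hε).congr' ?_
  filter_upwards [h] with N hN
  simp only [hN]

theorem TendstoProb.add (hY : TendstoProb P Y a) (hZ : TendstoProb P Z b) :
    TendstoProb P (fun N ω => Y N ω + Z N ω) (a + b) :=
  hY.map₂ hZ (h := fun x y => x + y) continuous_add.continuousAt

theorem TendstoProb.sub (hY : TendstoProb P Y a) (hZ : TendstoProb P Z b) :
    TendstoProb P (fun N ω => Y N ω - Z N ω) (a - b) :=
  hY.map₂ hZ (h := fun x y => x - y) continuous_sub.continuousAt

theorem TendstoProb.mul (hY : TendstoProb P Y a) (hZ : TendstoProb P Z b) :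
    TendstoProb P (fun N ω => Y N ω * Z N ω) (a * b) :=
  hY.map₂ hZ (h := fun x y => x * y) continuous_mul.continuousAt

theorem TendstoProb.div (hY : TendstoProb P Y a) (hZ : TendstoProb P Z b) (hb : b ≠ 0) :
    TendstoProb P (fun N ω => Y N ω / Z N ω) (a / b) :=
  hY.map₂ hZ (h := fun x y => x / y)
    (ContinuousAt.div continuousAt_fst continuousAt_snd hb)

theorem TendstoProb.mul_det {u : ℕ → ℝ} (hu : Tendsto u atTop (nhds a)) (hZ : TendstoProb P Z b) :
    TendstoProb P (fun N ω => u N * Z N ω) (a * b) :=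
  (tendstoProb_of_tendsto hu).mul hZ

/-- Chebyshev's inequality, as a criterion for convergence in probability. -/
theorem tendstoProb_of_sq {u : ℕ → ℝ} (hu : Tendsto u atTop (nhds 0))
    (h : ∀ᶠ N in atTop, IsProbabilityMeasure (P N) ∧ BddMeas (Z N) ∧
      ∫ ω, (Z N ω - a) ^ 2 ∂(P N) ≤ u N) : TendstoProb P Z a := by
  intro ε hε
  have hlim : Tendsto (fun N => ENNReal.ofReal (u N / ε ^ 2)) atTop (nhds 0) := by
    have := ENNReal.tendsto_ofReal (hu.div_const (ε ^ 2))
    simpa using this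
  refine tendsto_of_tendsto_of_tendsto_of_le_of_le' tendsto_const_nhds hlim
    (Eventually.of_forall fun _ => zero_le) ?_
  filter_upwards [h] with N ⟨hP, hB, hI⟩
  have hint : Integrable (fun ω => (Z N ω - a) ^ 2) (P N) :=
    ((hB.sub (.const a)).pow 2).integrable _
  have hM := mul_meas_ge_le_integral_of_nonneg (ae_of_all _ fun ω => sq_nonneg (Z N ω - a))
    hint (ε ^ 2)
  have hset : {ω | ε ^ 2 ≤ (Z N ω - a) ^ 2} = {ω | ε ≤ |Z N ω - a|} := by
    ext ω
    simp only [Set.mem_ofPred_eq]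
    rw [sq_le_sq, abs_of_pos hε]
  rw [hset] at hM
  rw [← ofReal_measureReal]
  refine ENNReal.ofReal_le_ofReal ?_
  rw [le_div_iff₀ (by positivity), mul_comm]
  exact hM.trans hI

end TendstoProb

section Npart

variable {c : ℕ → ℝ} {k p : ℕ}

theorem tendsto_npart (hc : 0 < c p) :
    Tendsto (fun N => (npart c N p : ℝ)) atTop atTop := by
  refine tendsto_atTop_mono (fun N => Nat.le_ceil (c p * (N : ℝ))) ?_
  exact tendsto_natCast_atTop_atTop.const_mul_atTop hc

theorem tendsto_inv_npart (hc : 0 < c p) :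
    Tendsto (fun N => (npart c N p : ℝ)⁻¹) atTop (nhds 0) :=
  tendsto_inv_atTop_zero.comp (tendsto_npart hc)

theorem tendsto_mul_inv_npart (hc : 0 < c p) :
    Tendsto (fun N : ℕ => (N : ℝ) * (npart c N p : ℝ)⁻¹) atTop (nhds (c p)⁻¹) := by
  have h := (tendsto_nat_ceil_mul_div_atTop hc.le).comp
    (tendsto_natCast_atTop_atTop (R := ℝ))
  refine (h.inv₀ hc.ne').congr fun N => ?_
  simp [npart, div_eq_mul_inv, mul_comm]

theorem eventually_le_npart (hc : ∀ p ≤ k, 0 < c p) (b : ℕ) :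
    ∀ᶠ N in atTop, ∀ p ≤ k, b ≤ npart c N p := by
  refine (eventually_all_finite (Set.finite_Iic k)).2 fun p hp => ?_
  filter_upwards [(tendsto_npart (hc p hp)).eventually_ge_atTop (b : ℝ)] with N hN
  exact_mod_cast hN

/-- First-order expansion of the bias-correction factor. -/
theorem tendsto_mul_prod_sub_one (hc : ∀ p ≤ k, 0 < c p) :
    Tendsto (fun N : ℕ => ∏ p ∈ Finset.range (k + 1),
        (npart c N p : ℝ) / ((npart c N p : ℝ) - 1)) atTop (nhds 1) ∧
    Tendsto (fun N : ℕ => (N : ℝ) * (∏ p ∈ Finset.range (k + 1),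
        (npart c N p : ℝ) / ((npart c N p : ℝ) - 1) - 1)) atTop
      (nhds (∑ p ∈ Finset.range (k + 1), (c p)⁻¹)) := by
  have hfac : ∀ p ≤ k, Tendsto (fun N : ℕ => (npart c N p : ℝ) / ((npart c N p : ℝ) - 1))
      atTop (nhds 1) := fun p hp => by
    have h := ((tendsto_inv_npart (hc p hp)).const_sub 1).inv₀ (by norm_num)
    rw [sub_zero, inv_one] at h
    refine h.congr' ?_
    filter_upwards [eventually_le_npart (fun q (hq : q ≤ p) => hc q (hq.trans hp)) 2] with N hN
    have h2 : (2 : ℝ) ≤ npart c N p := by exact_mod_cast hN p le_rfl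
    have h0 : (npart c N p : ℝ) ≠ 0 := by linarith
    have h1 : (npart c N p : ℝ) - 1 ≠ 0 := by linarith
    field_simp
  have hone : ∀ p ≤ k, Tendsto (fun N : ℕ =>
      (N : ℝ) * ((npart c N p : ℝ) / ((npart c N p : ℝ) - 1) - 1)) atTop (nhds (c p)⁻¹) :=
    fun p hp => by
    have h := (tendsto_mul_inv_npart (hc p hp)).mul (hfac p hp)
    rw [mul_one] at h
    refine h.congr' ?_
    filter_upwards [eventually_le_npart (fun q (hq : q ≤ p) => hc q (hq.trans hp)) 2] with N hN
    have h2 : (2 : ℝ) ≤ npart c N p := by exact_mod_cast hN p le_rfl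
    have h0 : (npart c N p : ℝ) ≠ 0 := by linarith
    have h1 : (npart c N p : ℝ) - 1 ≠ 0 := by linarith
    field_simp
    ring
  induction k with
  | zero => simpa using And.intro (hfac 0 le_rfl) (hone 0 le_rfl)
  | succ k ih =>
    obtain ⟨h1, h2⟩ := ih (fun p hp => hc p (by lia)) (fun p hp => hfac p (by lia))
      fun p hp => hone p (by lia)
    constructor
    · simpa [Finset.prod_range_succ _ (k + 1)] using h1.mul (hfac (k + 1) le_rfl)
    · have h3 := (h2.mul (hfac (k + 1) le_rfl)).add (hone (k + 1) le_rfl)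
      rw [mul_one, ← Finset.sum_range_succ] at h3
      refine h3.congr fun N => ?_
      rw [Finset.prod_range_succ _ (k + 1)]
      ring

end Npart

/-! ### Moment bounds for the coalescence statistics -/

section Transfer

variable {G : ℕ → X → ℝ} {Np : ℕ → ℕ} {k : ℕ} {r : ℕ → ℕ → ℝ} {f g : X → ℝ}

theorem exists_normC_sq_le (hG : ∀ p < k, IsPotential (G p)) :
    ∃ K, 0 < K ∧ ∀ Np : ℕ → ℕ, (∀ p < k, 1 ≤ Np p) → ∀ ω, normC G Np k ω ^ 2 ≤ K := by
  induction k with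
  | zero => exact ⟨1, one_pos, fun Np _ ω => by simp [normC]⟩
  | succ k ih =>
    have hk := k.lt_succ_self
    obtain ⟨K, hK, hb⟩ := ih fun p hp => hG p (hp.trans hk)
    obtain ⟨C, hC, hgC⟩ := (hG k hk).toBddMeas.exists_pos
    refine ⟨K * C ^ 2, by positivity, fun Np hN ω => ?_⟩
    rw [normC, Finset.prod_range_succ, mul_pow]
    exact mul_le_mul (hb Np (fun p hp => hN p (hp.trans hk)) ω)
      (sq_le_sq' (abs_le.1 (abs_etaN_le (hN k hk) hgC ω)).1
        (abs_le.1 (abs_etaN_le (hN k hk) hgC ω)).2) (sq_nonneg _) hK.le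

theorem wStat_rEq_nonneg (hf : ∀ x, 0 ≤ f x) (hg : ∀ x, 0 ≤ g x) (ω : PState X) :
    0 ≤ wStat rEq G Np k f g ω :=
  mul_nonneg (sq_nonneg _) (mul_nonneg (sq_nonneg _) (Finset.sum_nonneg fun i _ =>
    Finset.sum_nonneg fun j _ => mul_nonneg (by unfold rEq; split_ifs <;> simp)
      (mul_nonneg (hf _) (hg _))))

theorem wStat_rEq_le {C : ℝ} (hfg : ∀ x x', f x * g x' ≤ C) (ω : PState X) :
    wStat rEq G Np k f g ω ≤ C * wStat rEq G Np k 1 1 ω := by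
  have h : ∀ i j, rEq (eve ω.2 k i) (eve ω.2 k j) * (f (ω.1 k i) * g (ω.1 k j))
      ≤ C * (rEq (eve ω.2 k i) (eve ω.2 k j) * ((1 : X → ℝ) (ω.1 k i) * (1 : X → ℝ) (ω.1 k j))) :=
    fun i j => by
      have := hfg (ω.1 k i) (ω.1 k j)
      unfold rEq
      split_ifs
      · simpa using this
      · simp
  rw [wStat, wStat, mul_left_comm, pairStat, pairStat, mul_left_comm C]
  refine mul_le_mul_of_nonneg_left (mul_le_mul_of_nonneg_left ?_ (sq_nonneg _)) (sq_nonneg _)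
  simp only [Finset.mul_sum]
  exact Finset.sum_le_sum fun i _ => Finset.sum_le_sum fun j _ => h i j

variable (M : ℕ → Kernel X X)

/-- The conditional mean of `wStat rEq G Np (k + 1) f g` given the first `k` generations. -/
def wMean (G : ℕ → X → ℝ) (Np : ℕ → ℕ) (k : ℕ) (f g : X → ℝ) (ω : PState X) : ℝ :=
  (Np (k + 1) : ℝ)⁻¹ * (gammaN G Np k (G k) ω * gammaN G Np k (qOp M G k fun x => f x * g x) ω)
    + (1 - (Np (k + 1) : ℝ)⁻¹) * wStat rEq G Np k (qOp M G k f) (qOp M G k g) ω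

variable [∀ p, IsMarkovKernel (M p)]

theorem bddMeas_wMean (hG : ∀ p < k + 1, IsPotential (G p)) (hf : BddMeas f) (hg : BddMeas g) :
    BddMeas (wMean M G Np k f g) := by
  have hk := k.lt_succ_self
  have hGk := (hG k hk).toBddMeas
  have hG' : ∀ p < k, IsPotential (G p) := fun p hp => hG p (hp.trans hk)
  exact (((bddMeas_gammaN hG' hGk).mul (bddMeas_gammaN hG' (.qOp M hGk (hf.mul hg)))).const_mul
    _).add ((bddMeas_wStat abs_rEq_le hG' (.qOp M hGk hf) (.qOp M hGk hg)).const_mul _)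

variable [Nonempty X]

theorem normC_pfUpdate_of_le {m q : ℕ} (hq : q ≤ k) (ω : PState X) (y : Fin m → ℕ × X) :
    normC G Np q (pfUpdate k m ω y) = normC G Np q ω :=
  Finset.prod_congr rfl fun _ hp =>
    etaN_pfUpdate_of_le ((Finset.mem_range.1 hp).le.trans hq) ω y

theorem gammaN_pfUpdate_of_le {m q : ℕ} (hq : q ≤ k) (ω : PState X) (y : Fin m → ℕ × X) :
    gammaN G Np q f (pfUpdate k m ω y) = gammaN G Np q f ω := by
  rw [gammaN_eq, gammaN_eq, normC_pfUpdate_of_le hq, etaN_pfUpdate_of_le hq]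

theorem wStat_pfUpdate_of_le {m q : ℕ} (hq : q ≤ k) (ω : PState X) (y : Fin m → ℕ × X) :
    wStat r G Np q f g (pfUpdate k m ω y) = wStat r G Np q f g ω := by
  have h : eve (pfUpdate k m ω y).2 q = eve ω.2 q := eve_update hq
  simp only [wStat, pairStat, normC_pfUpdate_of_le hq, pfUpdate_fst_of_le hq, h]

theorem wMean_pfUpdate {m : ℕ} (ω : PState X) (y : Fin m → ℕ × X) :
    wMean M G Np k f g (pfUpdate k m ω y) = wMean M G Np k f g ω := by
  simp only [wMean, gammaN_pfUpdate_of_le le_rfl, wStat_pfUpdate_of_le le_rfl]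

variable (M0 : Measure X) [IsProbabilityMeasure M0]

theorem pfLaw_succ_apply (hG : ∀ p < k + 1, IsPotential (G p)) (hN : ∀ p < k + 1, 1 ≤ Np p)
    {s : Set (PState X)} (hs : MeasurableSet s)
    (hinv : ∀ ω (y : Fin (Np (k + 1)) → ℕ × X), pfUpdate k (Np (k + 1)) ω y ∈ s ↔ ω ∈ s) :
    pfLaw M0 M G Np (k + 1) s = pfLaw M0 M G Np k s := by
  have hk := k.lt_succ_self
  have := isProbabilityMeasure_pfLaw M0 M hG hN
  have := isProbabilityMeasure_pfLaw M0 M (fun p hp => hG p (hp.trans hk))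
    fun p hp => hN p (hp.trans hk)
  have hB : BddMeas (s.indicator (1 : PState X → ℝ)) :=
    ⟨measurable_one.indicator hs, 1, fun ω => by
      by_cases h : ω ∈ s <;> simp [h]⟩
  have hI := integral_pfLaw_succ M0 M hG hN hB
  have hstep : ∀ ω, ∫ y, s.indicator (1 : PState X → ℝ) (pfUpdate k (Np (k + 1)) ω y)
      ∂(Measure.pi fun _ => oneStep M G Np k (ω.1 k)) = s.indicator (1 : PState X → ℝ) ω :=
    fun ω => by
      have := isProbabilityMeasure_oneStep M (hG k hk) (hN k hk) (ω.1 k)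
      simp [Set.indicator, hinv]
  simp only [hstep] at hI
  rw [integral_indicator_one hs, integral_indicator_one hs] at hI
  rw [← ofReal_measureReal, hI, ofReal_measureReal]

/-- The mean square deviation from the conditional mean. -/
theorem integral_sq_wStat_sub_wMean_le (hG : ∀ p < k + 1, IsPotential (G p))
    (hN : ∀ p ≤ k + 1, 1 ≤ Np p) (hf : BddMeas f) (hg : BddMeas g) {C K δ : ℝ} (hC : 0 ≤ C)
    (hfg : ∀ x x', |f x * g x'| ≤ C) (hδ : 0 < δ) (hK : ∀ ω, normC G Np (k + 1) ω ^ 2 ≤ K) :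
    ∫ ω, (wStat rEq G Np (k + 1) f g ω - wMean M G Np k f g ω) ^ 2
        ∂(pfLaw M0 M G Np (k + 1))
      ≤ 4 * C ^ 2 * (δ * ∫ ω, wStat rEq G Np (k + 1) 1 1 ω ^ 2 ∂(pfLaw M0 M G Np (k + 1))
        + δ⁻¹ * (K * (Np (k + 1) : ℝ)⁻¹ ^ 2)
          * ∫ ω, wStat rEq G Np (k + 1) 1 1 ω ∂(pfLaw M0 M G Np (k + 1))) := by
  have hk := k.lt_succ_self
  have hN' : ∀ p < k + 1, 1 ≤ Np p := fun p hp => hN p hp.le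
  have := isProbabilityMeasure_pfLaw M0 M (fun p hp => hG p (hp.trans hk))
    fun p hp => hN' p (hp.trans hk)
  have := isMarkovKernel_stepKernel M (hG k hk) (hN' k hk)
  have hW := bddMeas_wStat (Np := Np) abs_rEq_le hG hf hg
  have hW1 := bddMeas_wStat (Np := Np) abs_rEq_le hG (BddMeas.one (α := X)) BddMeas.one
  have hstep : ∀ {F : PState X → ℝ}, BddMeas F → BddMeas fun ω =>
      ∫ y, F (pfUpdate k (Np (k + 1)) ω y) ∂(Measure.pi fun _ => oneStep M G Np k (ω.1 k)) :=
    fun hF => BddMeas.integral_kernel (piKernel (stepKernel M Np (hG k hk)) (Np (k + 1)))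
      (hF.comp (measurable_pfUpdate k _))
  have hmean : ∀ ω, wMean M G Np k f g ω
      = ∫ y, wStat rEq G Np (k + 1) f g (pfUpdate k (Np (k + 1)) ω y)
        ∂(Measure.pi fun _ => oneStep M G Np k (ω.1 k)) := fun ω => by
    rw [integral_wStat_step M (hG k hk) (hN' k hk) (hN _ le_rfl) abs_rEq_le
      (d := 1) (fun a => by simp [rEq]) hf hg, mul_one, wMean]
  rw [integral_pfLaw_succ M0 M hG hN' ((hW.sub (bddMeas_wMean M hG hf hg)).pow 2),
    integral_pfLaw_succ M0 M hG hN' (hW1.pow 2), integral_pfLaw_succ M0 M hG hN' hW1,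
    ← integral_const_mul, ← integral_const_mul, ← integral_add
      (((hstep (hW1.pow 2)).const_mul _).integrable _) (((hstep hW1).const_mul _).integrable _),
    ← integral_const_mul]
  refine integral_mono ((hstep ((hW.sub (bddMeas_wMean M hG hf hg)).pow 2)).integrable _)
    (((((hstep (hW1.pow 2)).const_mul _).add ((hstep hW1).const_mul _)).const_mul _).integrable _)
    fun ω => ?_
  simp only [wMean_pfUpdate]
  simp only [hmean]
  exact integral_sq_dev_wStat_step M hG (hN' k hk) hf hg hC hfg hδ ω (hK ω)

end Transfer

section Moments

variable (M0 : Measure X) [IsProbabilityMeasure M0] (M : ℕ → Kernel X X)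
  [∀ p, IsMarkovKernel (M p)] {G : ℕ → X → ℝ} {k : ℕ} {f g : X → ℝ} {c : ℕ → ℝ} [Nonempty X]

theorem integral_pfLaw_succ_of_invariant {Np : ℕ → ℕ} (hG : ∀ p < k + 1, IsPotential (G p))
    (hN : ∀ p < k + 1, 1 ≤ Np p) {F : PState X → ℝ} (hF : BddMeas F)
    (hinv : ∀ ω (y : Fin (Np (k + 1)) → ℕ × X), F (pfUpdate k (Np (k + 1)) ω y) = F ω) :
    ∫ ω, F ω ∂(pfLaw M0 M G Np (k + 1)) = ∫ ω, F ω ∂(pfLaw M0 M G Np k) := by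
  rw [integral_pfLaw_succ M0 M hG hN hF]
  refine integral_congr_ae (ae_of_all _ fun ω => ?_)
  have := isProbabilityMeasure_oneStep M (hG k k.lt_succ_self) (hN k k.lt_succ_self) (ω.1 k)
  simp [hinv]

/-- The rescaled coalescence statistics are bounded in `L²`. -/
theorem exists_integral_sq_wStat_le (hc : ∀ p ≤ k, 0 < c p)
    (hG : ∀ p < k, IsPotential (G p)) :
    ∃ B, ∀ᶠ N : ℕ in atTop,
      ∫ ω, ((N : ℝ) * wStat rEq G (npart c N) k 1 1 ω) ^ 2 ∂(pfLaw M0 M G (npart c N) k)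
        ≤ B := by
  have hd : ∀ a, rEq a a = 1 := fun a => by simp [rEq]
  induction k with
  | zero =>
    refine ⟨((c 0)⁻¹ + 1) ^ 2, ?_⟩
    filter_upwards [eventually_le_npart hc 1, (tendsto_mul_inv_npart (hc 0 le_rfl)).eventually_le_const
      (lt_add_one _)] with N hN hR
    have := isProbabilityMeasure_pfLaw M0 M (G := G) (Np := npart c N) (k := 0) (by simp) (by simp)
    have h0 : (npart c N 0 : ℝ) ≠ 0 := by
      have := hN 0 le_rfl
      positivity
    have he : ∀ a b, a ≠ b → rEq a b = 0 := fun a b h => by simp [rEq, h]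
    have hval : ∀ ω : PState X, wStat rEq G (npart c N) 0 1 1 ω = (npart c N 0 : ℝ)⁻¹ := fun ω => by
      rw [wStat, pairStat_zero hd he]
      simp [normC, etaN, h0]
    simp only [hval, integral_const, probReal_univ, one_smul]
    gcongr
  | succ k ih =>
    have hk := k.lt_succ_self
    have hG' : ∀ p < k, IsPotential (G p) := fun p hp => hG p (hp.trans hk)
    obtain ⟨B, hB⟩ := ih (fun p hp => hc p (hp.trans hk.le)) hG'
    obtain ⟨K, hK, hKb⟩ := exists_normC_sq_le hG
    obtain ⟨C, hC, hgC⟩ := (hG k hk).toBddMeas.exists_pos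
    set R := (c (k + 1))⁻¹ + 1 with hR
    have hR0 : 0 < R := add_pos (inv_pos.2 (hc _ le_rfl)) one_pos
    refine ⟨(256 * K * R) ^ 2 + 8 * (2 * (R * K) ^ 2 + 2 * C ^ 4 * B), ?_⟩
    filter_upwards [hB, eventually_le_npart hc 1, (tendsto_mul_inv_npart
      (hc (k + 1) le_rfl)).eventually_le_const (lt_add_one _)] with N hB hN hNR
    have hN' : ∀ p < k + 1, 1 ≤ npart c N p := fun p hp => hN p hp.le
    have hP := isProbabilityMeasure_pfLaw M0 M hG hN'
    have hP' := isProbabilityMeasure_pfLaw M0 M hG' fun p hp => hN' p (hp.trans hk)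
    have hW := bddMeas_wStat (Np := npart c N) abs_rEq_le hG (BddMeas.one (α := X)) BddMeas.one
    have hWk := bddMeas_wStat (Np := npart c N) abs_rEq_le hG' (BddMeas.one (α := X)) BddMeas.one
    have hm := bddMeas_wMean (Np := npart c N) M hG (BddMeas.one (α := X)) BddMeas.one
    set P := pfLaw M0 M G (npart c N) (k + 1)
    set W := wStat rEq G (npart c N) (k + 1) (1 : X → ℝ) 1
    set m := wMean M G (npart c N) k (1 : X → ℝ) 1 with hm_def
    set t : ℝ := (npart c N (k + 1) : ℝ)⁻¹ with ht
    have ht0 : 0 ≤ t := by positivity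
    have ht1 : t ≤ 1 := inv_le_one_of_one_le₀ (by exact_mod_cast hN _ le_rfl)
    have hvar := integral_sq_wStat_sub_wMean_le M M0 hG hN (BddMeas.one (α := X)) BddMeas.one
      (δ := 1 / 16) zero_le_one (by simp) (by norm_num) (hKb _ hN')
    have hmsq : ∫ ω, ((N : ℝ) * m ω) ^ 2 ∂P ≤ 2 * (R * K) ^ 2 + 2 * C ^ 4 * B := by
      have hsq : ∀ ω, ((N : ℝ) * m ω) ^ 2 ≤ 2 * (R * K) ^ 2
          + 2 * C ^ 4 * ((N : ℝ) * wStat rEq G (npart c N) k 1 1 ω) ^ 2 := fun ω => by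
        have hq1 : qOp M G k (1 : X → ℝ) = G k := funext fun x => qOp_one M x
        have hq2 : qOp M G k (fun x => (1 : X → ℝ) x * (1 : X → ℝ) x) = G k := by
          rw [← hq1]; congr 1; funext x; simp
        have hpos : ∀ x, 0 ≤ G k x := fun x => ((hG k hk).pos x).le
        have hGC : ∀ x, G k x ≤ C := fun x => (le_abs_self _).trans (hgC x)
        have hw0 := wStat_rEq_nonneg (G := G) (Np := npart c N) (k := k) hpos hpos ω
        have hw := wStat_rEq_le (G := G) (Np := npart c N) (k := k) (f := G k) (g := G k)
          (C := C ^ 2) (fun x x' => by nlinarith [hpos x, hpos x', hGC x, hGC x']) ω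
        have hn := hKb _ hN' ω
        have hmω : m ω = t * normC G (npart c N) (k + 1) ω ^ 2
            + (1 - t) * wStat rEq G (npart c N) k (G k) (G k) ω := by
          rw [hm_def, wMean, hq1, hq2, normC_succ, sq]
        have h1 : 0 ≤ (N : ℝ) * m ω := by
          rw [hmω]
          have : 0 ≤ 1 - t := by linarith
          positivity
        have h2 : (N : ℝ) * m ω ≤ R * K
            + C ^ 2 * ((N : ℝ) * wStat rEq G (npart c N) k 1 1 ω) := by
          have h3 : (N : ℝ) * t * normC G (npart c N) (k + 1) ω ^ 2 ≤ R * K :=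
            mul_le_mul hNR hn (sq_nonneg _) hR0.le
          have h4 : (N : ℝ) * ((1 - t) * wStat rEq G (npart c N) k (G k) (G k) ω)
              ≤ (N : ℝ) * (C ^ 2 * wStat rEq G (npart c N) k 1 1 ω) := by
            refine mul_le_mul_of_nonneg_left (le_trans ?_ hw) (Nat.cast_nonneg N)
            nlinarith
          rw [hmω]
          linarith
        calc ((N : ℝ) * m ω) ^ 2
            ≤ (R * K + C ^ 2 * ((N : ℝ) * wStat rEq G (npart c N) k 1 1 ω)) ^ 2 :=
              pow_le_pow_left₀ h1 h2 2
          _ ≤ _ := by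
              nlinarith [sq_nonneg (R * K - C ^ 2 * ((N : ℝ) * wStat rEq G (npart c N) k 1 1 ω))]
      have hBsq := ((hWk.const_mul (N : ℝ)).pow 2).const_mul (2 * C ^ 4)
      rw [integral_pfLaw_succ_of_invariant M0 M hG hN' ((hm.const_mul (N : ℝ)).pow 2)
        fun ω y => by rw [hm_def, wMean_pfUpdate]]
      refine (integral_mono (((hm.const_mul (N : ℝ)).pow 2).integrable _)
        (((BddMeas.const _).add hBsq).integrable _) hsq).trans ?_
      rw [integral_add ((BddMeas.const _).integrable _) (hBsq.integrable _),
        integral_const_mul (2 * C ^ 4)]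
      simp only [integral_const, probReal_univ, one_smul]
      gcongr
    have hWN := hW.const_mul (N : ℝ)
    have hmN := hm.const_mul (N : ℝ)
    have hsplit : ∫ ω, ((N : ℝ) * W ω) ^ 2 ∂P ≤ 2 * (N : ℝ) ^ 2 * ∫ ω, (W ω - m ω) ^ 2 ∂P
        + 2 * ∫ ω, ((N : ℝ) * m ω) ^ 2 ∂P := by
      have hD := (hW.sub hm).pow 2
      rw [← integral_const_mul, ← integral_const_mul,
        ← integral_add ((hD.const_mul _).integrable _) (((hmN.pow 2).const_mul _).integrable _)]
      refine integral_mono ((hWN.pow 2).integrable _)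
        (((hD.const_mul _).add ((hmN.pow 2).const_mul _)).integrable _) fun ω => ?_
      have := sq_nonneg ((N : ℝ) * W ω - 2 * ((N : ℝ) * m ω))
      simp only
      nlinarith
    have hS : ∫ ω, ((N : ℝ) * W ω) ^ 2 ∂P = (N : ℝ) ^ 2 * ∫ ω, W ω ^ 2 ∂P := by
      rw [← integral_const_mul]; simp only [mul_pow]
    have hZ : ∫ ω, (N : ℝ) * W ω ∂P = (N : ℝ) * ∫ ω, W ω ∂P := integral_const_mul _ _
    have hJ := sq_integral_le P hWN
    have hZ0 : 0 ≤ ∫ ω, (N : ℝ) * W ω ∂P := integral_nonneg fun ω =>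
      mul_nonneg (Nat.cast_nonneg N)
        (wStat_rEq_nonneg (fun _ => zero_le_one) (fun _ => zero_le_one) ω)
    have hNtt : (N : ℝ) * t * t ≤ R := by nlinarith [mul_nonneg (Nat.cast_nonneg N) ht0]
    have hmain : (N : ℝ) ^ 2 * ∫ ω, (W ω - m ω) ^ 2 ∂P
        ≤ 1 / 4 * (∫ ω, ((N : ℝ) * W ω) ^ 2 ∂P) + 64 * K * R * ∫ ω, (N : ℝ) * W ω ∂P := by
      have h1 := mul_le_mul_of_nonneg_left hvar (sq_nonneg (N : ℝ))
      have h2 := mul_le_mul_of_nonneg_right hNtt (mul_nonneg (mul_nonneg (by norm_num : (0:ℝ) ≤ 64)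
        hK.le) hZ0)
      rw [hS]
      rw [hZ] at h2 ⊢
      refine h1.trans ?_
      rw [← ht]
      norm_num
      linarith
    nlinarith [sq_nonneg (256 * K * R - ∫ ω, (N : ℝ) * W ω ∂P)]

end Moments

/-! ### Laws of large numbers -/

section Limits

variable (M0 : Measure X) [IsProbabilityMeasure M0] (M : ℕ → Kernel X X)
  [∀ p, IsMarkovKernel (M p)] {G : ℕ → X → ℝ} {k : ℕ} {f g : X → ℝ} {c : ℕ → ℝ} [Nonempty X]

theorem tendsto_integral_gammaN_mul (hc : ∀ p ≤ k, 0 < c p) (hG : ∀ p < k, IsPotential (G p))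
    (hf : BddMeas f) (hg : BddMeas g) :
    Tendsto (fun N => ∫ ω, gammaN G (npart c N) k f ω * gammaN G (npart c N) k g ω
        ∂(pfLaw M0 M G (npart c N) k)) atTop
      (nhds (gInt M0 M G k f * gInt M0 M G k g)) := by
  induction k generalizing f g with
  | zero =>
    have ht := tendsto_inv_npart (hc 0 le_rfl)
    have h := (ht.mul_const (∫ x, f x * g x ∂M0)).add
      ((ht.const_sub 1).mul_const ((∫ x, f x ∂M0) * ∫ x, g x ∂M0))
    simp only [zero_mul, zero_add, sub_zero, one_mul] at h
    refine h.congr' ?_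
    filter_upwards [eventually_le_npart hc 1] with N hN
    rw [← integral_etaN_mul_zero M0 M (G := G) (hN 0 le_rfl) hf hg]
    simp [gammaN]
  | succ k ih =>
    have hk := k.lt_succ_self
    have hG' : ∀ p < k, IsPotential (G p) := fun p hp => hG p (hp.trans hk)
    have hGk := (hG k hk).toBddMeas
    have hQ : ∀ {h : X → ℝ}, BddMeas h → BddMeas (qOp M G k h) := fun hh => .qOp M hGk hh
    have hc' : ∀ p ≤ k, 0 < c p := fun p hp => hc p (hp.trans hk.le)
    have ht := tendsto_inv_npart (hc (k + 1) le_rfl)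
    have h := (ht.mul (ih hc' hG' hGk (hQ (hf.mul hg)))).add
      ((ht.const_sub 1).mul (ih hc' hG' (hQ hf) (hQ hg)))
    simp only [zero_mul, zero_add, sub_zero, one_mul] at h
    rw [gInt_succ M0 M hG hf, gInt_succ M0 M hG hg]
    refine h.congr' ?_
    filter_upwards [eventually_le_npart hc 1] with N hN
    have hN' : ∀ p < k + 1, 1 ≤ npart c N p := fun p hp => hN p hp.le
    have := isProbabilityMeasure_pfLaw M0 M hG' fun p hp => hN' p (hp.trans hk)
    rw [integral_pfLaw_succ M0 M hG hN' ((bddMeas_gammaN hG hf).mul (bddMeas_gammaN hG hg))]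
    simp only [← wStat_one]
    have hstep : ∀ ω, ∫ y, wStat (fun _ _ => 1) G (npart c N) (k + 1) f g
        (pfUpdate k (npart c N (k + 1)) ω y)
        ∂(Measure.pi fun _ => oneStep M G (npart c N) k (ω.1 k)) = _ := fun ω =>
      integral_wStat_step M (hG k hk) (hN' k hk) (hN _ le_rfl) (by simp) (fun _ => rfl) hf hg ω
    simp only [hstep, mul_one, ← wStat_one]
    have hb : ∀ {u v : X → ℝ}, BddMeas u → BddMeas v →
        BddMeas (wStat (fun _ _ => 1) G (npart c N) k u v) := fun hu hv =>
      bddMeas_wStat (by simp) hG' hu hv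
    rw [integral_add (((hb hGk (hQ (hf.mul hg))).const_mul _).integrable _)
      (((hb (hQ hf) (hQ hg)).const_mul _).integrable _), integral_const_mul, integral_const_mul]

/-- Weak law of large numbers for `γ_k^N`. -/
theorem tendstoProb_gammaN (hc : ∀ p ≤ k, 0 < c p) (hG : ∀ p < k, IsPotential (G p))
    (hf : BddMeas f) :
    TendstoProb (fun N => pfLaw M0 M G (npart c N) k) (fun N => gammaN G (npart c N) k f)
      (gInt M0 M G k f) := by
  have h := (tendsto_integral_gammaN_mul M0 M hc hG hf hf).sub_const (gInt M0 M G k f ^ 2)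
  rw [sq, sub_self] at h
  refine tendstoProb_of_sq h ?_
  filter_upwards [eventually_le_npart hc 1] with N hN
  have hP := isProbabilityMeasure_pfLaw M0 M hG fun p hp => hN p hp.le
  have hB := bddMeas_gammaN (Np := npart c N) hG hf
  refine ⟨hP, hB, le_of_eq ?_⟩
  have h := integral_sq_dev (pfLaw M0 M G (npart c N) k) hB
  rw [integral_gammaN M0 M hG hN hf] at h
  rw [h]
  simp only [sq]

/-- The rescaled deviation from the conditional mean vanishes in probability. -/
theorem tendstoProb_wStat_sub_wMean (hc : ∀ p ≤ k + 1, 0 < c p)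
    (hG : ∀ p < k + 1, IsPotential (G p)) (hf : BddMeas f) (hg : BddMeas g) :
    TendstoProb (fun N => pfLaw M0 M G (npart c N) (k + 1))
      (fun N ω => (N : ℝ) * wStat rEq G (npart c N) (k + 1) f g ω
        - N * wMean M G (npart c N) k f g ω) 0 := by
  obtain ⟨Cf, hCf, hfC⟩ := hf.exists_pos
  obtain ⟨Cg, hCg, hgC⟩ := hg.exists_pos
  obtain ⟨K, hK, hKb⟩ := exists_normC_sq_le hG
  obtain ⟨B, hB⟩ := exists_integral_sq_wStat_le M0 M hc hG
  set C := Cf * Cg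
  have hfg : ∀ x x', |f x * g x'| ≤ C := fun x x' => by
    rw [abs_mul]
    exact mul_le_mul (hfC x) (hgC x') (abs_nonneg _) hCf.le
  set R := (c (k + 1))⁻¹ + 1
  have hR0 : 0 < R := add_pos (inv_pos.2 (hc _ le_rfl)) one_pos
  have hu : Tendsto (fun N => 4 * C ^ 2 * (B + K * R * (1 + B))
      * √((npart c N (k + 1) : ℝ)⁻¹)) atTop (nhds 0) := by
    have h := ((tendsto_inv_npart (hc (k + 1) le_rfl)).sqrt).const_mul
      (4 * C ^ 2 * (B + K * R * (1 + B)))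
    simpa using h
  refine tendstoProb_of_sq hu ?_
  filter_upwards [hB, eventually_le_npart hc 1, (tendsto_mul_inv_npart
      (hc (k + 1) le_rfl)).eventually_le_const (lt_add_one _)] with N hB hN hNR
  have hN' : ∀ p < k + 1, 1 ≤ npart c N p := fun p hp => hN p hp.le
  have hP := isProbabilityMeasure_pfLaw M0 M hG hN'
  have hW1 := bddMeas_wStat (Np := npart c N) abs_rEq_le hG (BddMeas.one (α := X)) BddMeas.one
  refine ⟨hP, ((bddMeas_wStat abs_rEq_le hG hf hg).const_mul _).sub
    ((bddMeas_wMean M hG hf hg).const_mul _), ?_⟩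
  have hn : (0 : ℝ) < npart c N (k + 1) := by exact_mod_cast hN (k + 1) le_rfl
  set t : ℝ := (npart c N (k + 1) : ℝ)⁻¹ with ht
  have ht0 : 0 < t := inv_pos.2 hn
  set s := √t
  have hs0 : 0 < s := Real.sqrt_pos.2 ht0
  have hst : t = s ^ 2 := (Real.sq_sqrt ht0.le).symm
  have hvar := integral_sq_wStat_sub_wMean_le M M0 hG hN hf hg (δ := s)
    (mul_pos hCf hCg).le hfg hs0 (hKb _ hN')
  rw [← ht] at hvar
  set P := pfLaw M0 M G (npart c N) (k + 1)
  set W := wStat rEq G (npart c N) (k + 1) (1 : X → ℝ) 1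
  have hS : ∫ ω, ((N : ℝ) * W ω) ^ 2 ∂P = (N : ℝ) ^ 2 * ∫ ω, W ω ^ 2 ∂P := by
    rw [← integral_const_mul]; simp only [mul_pow]
  have hZ : ∫ ω, (N : ℝ) * W ω ∂P = (N : ℝ) * ∫ ω, W ω ∂P := integral_const_mul _ _
  have hJ := sq_integral_le P (hW1.const_mul (N : ℝ))
  rw [hS] at hJ hB
  rw [hZ] at hJ
  have hJ' : (N : ℝ) * ∫ ω, W ω ∂P ≤ 1 + B := by nlinarith
  have hW0 : 0 ≤ ∫ ω, W ω ∂P := integral_nonneg fun ω =>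
    wStat_rEq_nonneg (fun _ => zero_le_one) (fun _ => zero_le_one) ω
  have hmain : ((N : ℝ) * t) * ((N : ℝ) * ∫ ω, W ω ∂P) ≤ R * (1 + B) :=
    mul_le_mul hNR hJ' (mul_nonneg (Nat.cast_nonneg N) hW0) hR0.le
  have heq : ∀ u v : ℝ, ((N : ℝ) * u - N * v - 0) ^ 2 = (N : ℝ) ^ 2 * (u - v) ^ 2 :=
    fun u v => by ring
  simp only [heq]
  rw [integral_const_mul]
  refine (mul_le_mul_of_nonneg_left hvar (sq_nonneg (N : ℝ))).trans ?_
  have hsi : s⁻¹ * (K * t ^ 2) = K * t * s := by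
    rw [hst]; field_simp
  rw [hsi]
  calc (N : ℝ) ^ 2 * (4 * C ^ 2 * (s * ∫ ω, W ω ^ 2 ∂P + K * t * s * ∫ ω, W ω ∂P))
      = 4 * C ^ 2 * s * ((N : ℝ) ^ 2 * ∫ ω, W ω ^ 2 ∂P
          + K * (((N : ℝ) * t) * ((N : ℝ) * ∫ ω, W ω ∂P))) := by ring
    _ ≤ 4 * C ^ 2 * s * (B + K * (R * (1 + B))) := by gcongr
    _ = _ := by ring

/-- The rescaled coalescence statistics converge in probability. -/
theorem tendstoProb_wStat_rEq (hc : ∀ p ≤ k, 0 < c p) (hG : ∀ p < k, IsPotential (G p))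
    (hf : BddMeas f) (hg : BddMeas g) :
    TendstoProb (fun N => pfLaw M0 M G (npart c N) k)
      (fun N ω => (N : ℝ) * wStat rEq G (npart c N) k f g ω) (coalLim M0 M G c k f g) := by
  induction k generalizing f g with
  | zero =>
    rw [coalLim_zero M0 M c hf hg]
    refine (TendstoProb.mul_det (tendsto_mul_inv_npart (hc 0 le_rfl))
      (tendstoProb_gammaN M0 M hc hG (hf.mul hg))).congr (Eventually.of_forall fun N ω => ?_)
    rw [wStat, pairStat_zero (d := 1) (e := 0) (fun a => by simp [rEq])
      fun a b h => by simp [rEq, h]]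
    simp [normC, gammaN, mul_assoc]
  | succ k ih =>
    have hk := k.lt_succ_self
    have hG' : ∀ p < k, IsPotential (G p) := fun p hp => hG p (hp.trans hk)
    have hGk := (hG k hk).toBddMeas
    have hQ : ∀ {h : X → ℝ}, BddMeas h → BddMeas (qOp M G k h) := fun hh => .qOp M hGk hh
    have hc' : ∀ p ≤ k, 0 < c p := fun p hp => hc p (hp.trans hk.le)
    have ht := tendsto_inv_npart (hc (k + 1) le_rfl)
    have hmean : TendstoProb (fun N => pfLaw M0 M G (npart c N) k)
        (fun N ω => (N : ℝ) * wMean M G (npart c N) k f g ω)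
        (coalLim M0 M G c (k + 1) f g) := by
      rw [coalLim_succ M0 M c hG hf hg]
      have h := (TendstoProb.mul_det (tendsto_mul_inv_npart (hc (k + 1) le_rfl))
        ((tendstoProb_gammaN M0 M hc' hG' hGk).mul
          (tendstoProb_gammaN M0 M hc' hG' (hQ (hf.mul hg))))).add
        (TendstoProb.mul_det (ht.const_sub 1) (ih hc' hG' (hQ hf) (hQ hg)))
      rw [sub_zero, one_mul] at h
      refine h.congr (Eventually.of_forall fun N ω => ?_)
      rw [wMean]
      ring
    have hmean' : TendstoProb (fun N => pfLaw M0 M G (npart c N) (k + 1))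
        (fun N ω => (N : ℝ) * wMean M G (npart c N) k f g ω)
        (coalLim M0 M G c (k + 1) f g) := fun ε hε => by
      refine (hmean ε hε).congr' ?_
      filter_upwards [eventually_le_npart hc 1] with N hN
      have hm := ((bddMeas_wMean (Np := npart c N) M hG hf hg).const_mul (N : ℝ)).measurable
      refine (pfLaw_succ_apply M M0 hG (fun p hp => hN p hp.le)
        (measurableSet_le measurable_const (hm.sub_const _).abs) fun ω y => ?_).symm
      simp only [Set.mem_ofPred_eq, wMean_pfUpdate]
    have h := (tendstoProb_wStat_sub_wMean M0 M hc hG hf hg).add hmean'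
    rw [zero_add] at h
    exact h.congr (Eventually.of_forall fun N ω => by ring)

end Limits

/-! ### Consistency of the variance estimator -/

section Bilinear

variable {G : ℕ → X → ℝ} {Np : ℕ → ℕ} {k : ℕ}

theorem gammaN_sub_const_mul (d : ℝ) (f g : X → ℝ) (ω : PState X) :
    gammaN G Np k (fun x => f x - d * g x) ω = gammaN G Np k f ω - d * gammaN G Np k g ω := by
  simp only [gammaN, etaN, Finset.sum_sub_distrib, ← Finset.mul_sum]
  ring

theorem wStat_sub_const_mul (r : ℕ → ℕ → ℝ) (d : ℝ) (f g : X → ℝ) (ω : PState X) :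
    wStat r G Np k (fun x => f x - d * g x) (fun x => f x - d * g x) ω
      = wStat r G Np k f f ω - d * (wStat r G Np k f g ω + wStat r G Np k g f ω)
        + d ^ 2 * wStat r G Np k g g ω := by
  have h : ∀ a u v u' v' : ℝ, a * ((u - d * v) * (u' - d * v'))
      = a * (u * u') - d * (a * (u * v')) - d * (a * (v * u')) + d ^ 2 * (a * (v * v')) :=
    fun a u v u' v' => by ring
  simp only [wStat, pairStat, h, Finset.sum_add_distrib, Finset.sum_sub_distrib,
    ← Finset.mul_sum]
  ring

/-- The estimator in terms of the coalescence statistic `wStat rEq`. -/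
theorem mul_VestHat (hG : IsPotential (G k)) (hGn : ∀ p < k, IsPotential (G p))
    (hN : ∀ p ≤ k, 2 ≤ Np p) (a : ℝ) (f : X → ℝ) (ω : PState X) :
    a * VestHat G Np k f ω
      = ((∏ p ∈ Finset.range (k + 1), (Np p : ℝ) / ((Np p : ℝ) - 1))
            * (a * wStat rEq G Np k (hatf G k f) (hatf G k f) ω)
          - a * (∏ p ∈ Finset.range (k + 1), (Np p : ℝ) / ((Np p : ℝ) - 1) - 1)
            * gammaN G Np k (hatf G k f) ω ^ 2)
        / gammaN G Np k (G k) ω ^ 2 := by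
  have hpos : gammaN G Np k (G k) ω ≠ 0 := by
    rw [← normC_succ]
    refine (Finset.prod_pos fun p hp => ?_).ne'
    have hp' := Nat.lt_succ_iff_lt_or_eq.1 (Finset.mem_range.1 hp)
    refine etaN_pos ?_ ((by norm_num : 1 ≤ 2).trans (hN p (Nat.lt_succ_iff.1
      (Finset.mem_range.1 hp)))) ω
    rcases hp' with h | rfl
    exacts [hGn p h, hG]
  have h := gammaHatN_one_sq_mul_VestHat (Np := Np) hG (hN k le_rfl) f ω
  have h1 : hatf G k 1 = G k := by funext x; simp [hatf]
  rw [gammaHatN, h1, normC_sq_mul_Vest (hN k le_rfl), wStat_rNe] at h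
  rw [eq_div_iff (pow_ne_zero 2 hpos), mul_assoc, mul_comm (VestHat G Np k f ω), h]
  ring

end Bilinear

section Consistency

variable (M0 : Measure X) [IsProbabilityMeasure M0] (M : ℕ → Kernel X X)
  [∀ p, IsMarkovKernel (M p)] {G : ℕ → X → ℝ} {k : ℕ} {f : X → ℝ} {c : ℕ → ℝ} [Nonempty X]

/-- Consistency of the estimator for a random, asymptotically negligible, centring. -/
theorem tendstoProb_mul_VestHat (hc : ∀ p ≤ k, 0 < c p) (hG : ∀ p < k + 1, IsPotential (G p))
    (hf : BddMeas f) {D : ℕ → PState X → ℝ}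
    (hD : TendstoProb (fun N => pfLaw M0 M G (npart c N) k) D 0) :
    TendstoProb (fun N => pfLaw M0 M G (npart c N) k)
      (fun N ω => (N : ℝ) * VestHat G (npart c N) k (fun x => f x - D N ω) ω)
      (sigma2Hat M0 M G c k f) := by
  have hk := k.lt_succ_self
  have hG' : ∀ p < k, IsPotential (G p) := fun p hp => hG p (hp.trans hk)
  have hGk := (hG k hk).toBddMeas
  have hF : BddMeas (hatf G k f) := hGk.mul hf
  obtain ⟨hP, hP'⟩ := tendsto_mul_prod_sub_one hc
  have hpos : gInt M0 M G k (G k) ≠ 0 := (gInt_pos M0 M hG' (hG k hk)).ne'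
  have hγ := tendstoProb_gammaN M0 M hc hG' hGk
  have hγF := (tendstoProb_gammaN M0 M hc hG' hF).sub (hD.mul hγ)
  have hW := ((tendstoProb_wStat_rEq M0 M hc hG' hF hF).sub
    (hD.mul ((tendstoProb_wStat_rEq M0 M hc hG' hF hGk).add
      (tendstoProb_wStat_rEq M0 M hc hG' hGk hF)))).add
    ((hD.mul hD).mul (tendstoProb_wStat_rEq M0 M hc hG' hGk hGk))
  have hmain := ((TendstoProb.mul_det hP hW).sub (TendstoProb.mul_det hP' (hγF.mul hγF))).div
    (hγ.mul hγ) (mul_ne_zero hpos hpos)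
  have hlim : sigma2Hat M0 M G c k f = (1 * (coalLim M0 M G c k (hatf G k f) (hatf G k f)
      - 0 * (coalLim M0 M G c k (hatf G k f) (G k) + coalLim M0 M G c k (G k) (hatf G k f))
      + 0 * 0 * coalLim M0 M G c k (G k) (G k))
      - (∑ p ∈ Finset.range (k + 1), (c p)⁻¹)
        * ((gInt M0 M G k (hatf G k f) - 0 * gInt M0 M G k (G k))
          * (gInt M0 M G k (hatf G k f) - 0 * gInt M0 M G k (G k))))
      / (gInt M0 M G k (G k) * gInt M0 M G k (G k)) := by
    rw [sigma2Hat_eq M0 M c hG hf]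
    ring
  rw [hlim]
  refine hmain.congr ?_
  filter_upwards [eventually_le_npart hc 2] with N hN ω
  have hhat : hatf G k (fun x => f x - D N ω) = fun x => hatf G k f x - D N ω * G k x := by
    funext x; simp only [hatf]; ring
  rw [mul_VestHat (hG k hk) hG' hN, hhat, gammaN_sub_const_mul, wStat_sub_const_mul]
  ring

/-- Consistency of the self-normalized particle approximation. -/
theorem tendstoProb_etaHatN (hc : ∀ p ≤ k, 0 < c p) (hG : ∀ p < k + 1, IsPotential (G p))
    (hf : BddMeas f) :
    TendstoProb (fun N => pfLaw M0 M G (npart c N) k) (fun N => etaHatN G (npart c N) k f)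
      (eHatInt M0 M G k f) := by
  have hk := k.lt_succ_self
  have hG' : ∀ p < k, IsPotential (G p) := fun p hp => hG p (hp.trans hk)
  have h1 : hatf G k 1 = G k := by funext x; simp [hatf]
  refine (tendstoProb_gammaN M0 M hc hG' ((hG k hk).toBddMeas.mul hf)).div
    (tendstoProb_gammaN M0 M hc hG' ((hG k hk).toBddMeas.mul BddMeas.one)) ?_
  change gInt M0 M G k (hatf G k 1) ≠ 0
  rw [h1]
  exact (gInt_pos M0 M hG' (hG k hk)).ne'

end Consistency

open PFVar MeasureTheory ProbabilityTheory Filter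

theorem statement17
    {X : Type*} [MeasurableSpace X] [Nonempty X] (hX : ∃ x y : X, x ≠ y) (n : ℕ)
    (M0 : Measure X) [IsProbabilityMeasure M0]
    (M : ℕ → Kernel X X) [∀ p, IsMarkovKernel (M p)]
    (G : ℕ → X → ℝ) (hGm : ∀ p ≤ n, Measurable (G p))
    (hGpos : ∀ p ≤ n, ∀ x, 0 < G p x) (hGbd : ∀ p ≤ n, ∃ C, ∀ x, G p x ≤ C)
    (c : ℕ → ℝ) (hc : ∀ p ≤ n, 0 < c p)
    (φ : X → ℝ) (hφm : Measurable φ) (hφb : ∃ C, ∀ x, |φ x| ≤ C) :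
    (∀ N : ℕ, 1 ≤ N → (∀ p ≤ n, 2 ≤ npart c N p) →
      ∫ ω, gammaHatN G (npart c N) n (1 : X → ℝ) ω ^ 2 * VestHat G (npart c N) n φ ω
          ∂(pfLaw M0 M G (npart c N) n)
        = variance (fun ω => gammaHatN G (npart c N) n φ ω)
            (pfLaw M0 M G (npart c N) n)) ∧
    (∀ ε : ℝ, 0 < ε →
      Tendsto (fun N : ℕ =>
          pfLaw M0 M G (npart c N) n
            {ω | ε ≤ |(N : ℝ) * VestHat G (npart c N) n φ ω - sigma2Hat M0 M G c n φ|})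
        atTop (nhds 0)) ∧
    (∀ ε : ℝ, 0 < ε →
      Tendsto (fun N : ℕ =>
          pfLaw M0 M G (npart c N) n
            {ω | ε ≤ |(N : ℝ) * VestHat G (npart c N) n
                  (fun x => φ x - etaHatN G (npart c N) n φ ω) ω
                - sigma2Hat M0 M G c n fun x => φ x - eHatInt M0 M G n φ|})
        atTop (nhds 0)) := by
  have hG : ∀ p ≤ n, IsPotential (G p) := fun p hp =>
    ⟨⟨hGm p hp, (hGbd p hp).imp fun C hC x => by rw [abs_of_pos (hGpos p hp x)]; exact hC x⟩,
      hGpos p hp⟩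
  have hG' : ∀ p < n + 1, IsPotential (G p) := fun p hp => hG p (Nat.lt_succ_iff.1 hp)
  have hφ : BddMeas φ := ⟨hφm, hφb⟩
  refine ⟨fun N _ hN => integral_VestHat M0 M hG hN hφ, ?_, ?_⟩
  · have h := tendstoProb_mul_VestHat M0 M hc hG' hφ (tendstoProb_of_tendsto tendsto_const_nhds)
    simp only [sub_zero] at h
    exact h
  · have h := tendstoProb_mul_VestHat M0 M hc hG' (hφ.sub (.const (eHatInt M0 M G n φ)))
      (D := fun N ω => etaHatN G (npart c N) n φ ω - eHatInt M0 M G n φ) (by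
        have := (tendstoProb_etaHatN M0 M hc hG' hφ).sub
          (tendstoProb_of_tendsto (tendsto_const_nhds (x := eHatInt M0 M G n φ)))
        rwa [sub_self] at this)
    simp only [sub_sub_sub_cancel_right] at h
    exact h
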